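/- arXiv:2603.09299 — 7 statements merged into one kernel-verified Lean document; each statement's English description precedes it below -/
import Mathlib

section
/- Suppose CG ≥ Cp, h1/μ1 ≤ h2/μ2 and μ1 < μ2. Then for every triple (j,k,l) of natural numbers with j ≥ 1 and j+k+l = Cp, there exists a natural number N such that for all natural numbers i ≥ N one has D(i,j,k,l) = v(i,j-1,k+1,l) − v(i,j-1,k,l+1) ≥ 0. -/
/-- Total service rate `d(j,k,l) = j·μ0 + k·μ1 + min(l,CG)·μ2`. -/
noncomputable def dRate (μ0 μ1 μ2 : ℝ) (CG j k l : ℕ) : ℝ :=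
  (j : ℝ) * μ0 + (k : ℝ) * μ1 + ((min l CG : ℕ) : ℝ) * μ2

/-- The value function `v`, defined by well-founded recursion on `2(i+j)+k+l`.
For nonzero states of the state space it satisfies
`d(j,k,l) · v i j k l = holding costs + transition terms`
(terms with zero coefficient are guarded by `if` and contribute `0`). -/
noncomputable def v (μ0 μ1 μ2 h0 h1 h2 : ℝ) (CG : ℕ) : ℕ → ℕ → ℕ → ℕ → ℝ
  | 0, 0, 0, 0 => 0
  | 0, j, k, l =>
    ((j : ℝ) * h0 + (k : ℝ) * h1 + (l : ℝ) * h2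
      + (if _ : 1 ≤ j then
          (j : ℝ) * μ0 *
            min (v μ0 μ1 μ2 h0 h1 h2 CG 0 (j - 1) (k + 1) l)
                (v μ0 μ1 μ2 h0 h1 h2 CG 0 (j - 1) k (l + 1))
        else 0)
      + (if _ : 1 ≤ k then (k : ℝ) * μ1 * v μ0 μ1 μ2 h0 h1 h2 CG 0 j (k - 1) l else 0)
      + (if _ : 1 ≤ l then
          ((min l CG : ℕ) : ℝ) * μ2 * v μ0 μ1 μ2 h0 h1 h2 CG 0 j k (l - 1)
        else 0))
    / dRate μ0 μ1 μ2 CG j k l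
  | i + 1, j, k, l =>
    (((i : ℝ) + 1 + (j : ℝ)) * h0 + (k : ℝ) * h1 + (l : ℝ) * h2
      + (if _ : 1 ≤ j then
          (j : ℝ) * μ0 *
            min (v μ0 μ1 μ2 h0 h1 h2 CG (i + 1) (j - 1) (k + 1) l)
                (v μ0 μ1 μ2 h0 h1 h2 CG (i + 1) (j - 1) k (l + 1))
        else 0)
      + (if _ : 1 ≤ k then (k : ℝ) * μ1 * v μ0 μ1 μ2 h0 h1 h2 CG i (j + 1) (k - 1) l else 0)
      + (if _ : 1 ≤ l then
          ((min l CG : ℕ) : ℝ) * μ2 * v μ0 μ1 μ2 h0 h1 h2 CG i (j + 1) k (l - 1)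
        else 0))
    / dRate μ0 μ1 μ2 CG j k l
termination_by i j k l => 2 * (i + j) + k + l
decreasing_by all_goals omega

/-- Membership in the state space `X`. -/
def memX (Cp : ℕ) (i j k l : ℕ) : Prop :=
  (i = 0 ∧ j + k + l < Cp) ∨ j + k + l = Cp

theorem v_succ (μ0 μ1 μ2 h0 h1 h2 : ℝ) (CG i j k l : ℕ) (hd : 0 < (j : ℝ) * μ0 + k * μ1 + l * μ2)
    (hl : l ≤ CG) :
    ((j : ℝ) * μ0 + k * μ1 + l * μ2) * v μ0 μ1 μ2 h0 h1 h2 CG (i + 1) j k l =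
      ((i : ℝ) + 1 + j) * h0 + k * h1 + l * h2
      + j * (μ0 * min (v μ0 μ1 μ2 h0 h1 h2 CG (i + 1) (j - 1) (k + 1) l)
                (v μ0 μ1 μ2 h0 h1 h2 CG (i + 1) (j - 1) k (l + 1)))
      + k * (μ1 * v μ0 μ1 μ2 h0 h1 h2 CG i (j + 1) (k - 1) l)
      + l * (μ2 * v μ0 μ1 μ2 h0 h1 h2 CG i (j + 1) k (l - 1)) := by
  rw [v]
  unfold dRate
  rw [min_eq_left hl, mul_div_cancel₀ _ hd.ne']
  have e : ∀ (n : ℕ) (x y : ℝ), (if _ : 1 ≤ n then (n : ℝ) * x * y else 0) = n * (x * y) := by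
    intro n x y
    rcases Nat.eq_zero_or_pos n with h | h
    · subst h; simp
    · rw [dif_pos (by omega)]; ring
  rw [e, e, e]

theorem base_bound (n : ℕ) (f : ℕ → ℕ → ℕ → ℝ) :
    ∃ C : ℝ, 0 ≤ C ∧ ∀ j k l, j + k + l = n → -C ≤ f j k l := by
  let S := Finset.range (n + 1) ×ˢ (Finset.range (n + 1) ×ˢ Finset.range (n + 1))
  refine ⟨∑ p ∈ S, |f p.1 p.2.1 p.2.2|, Finset.sum_nonneg fun _ _ => abs_nonneg _, ?_⟩
  intro j k l h
  have := Finset.single_le_sum (f := fun p : ℕ × ℕ × ℕ => |f p.1 p.2.1 p.2.2|) (s := S)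
    (fun _ _ => abs_nonneg _) (a := (j, k, l))
    (by simp only [S, Finset.mem_product, Finset.mem_range]; omega)
  have h2 := neg_abs_le (f j k l)
  simp only at this
  linarith

theorem min_sub (a b c d : ℝ) : min (a - c) (b - d) ≤ min a b - min c d := by
  rcases le_total a b with h | h
  · rw [min_eq_left h]
    have := min_le_left c d
    have := min_le_left (a - c) (b - d)
    linarith
  · rw [min_eq_right h]
    have := min_le_right c d
    have := min_le_right (a - c) (b - d)
    linarith

theorem growth (μ0 μ1 μ2 α c C : ℝ) (n : ℕ) (f : ℕ → ℕ → ℕ → ℕ → ℝ)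
    (hμ0 : 0 < μ0) (hμ1 : 0 < μ1) (hμ2 : 0 < μ2)
    (hd : ∀ j k l : ℕ, j + k + l = n → 0 < (j : ℝ) * μ0 + k * μ1 + l * μ2 + α)
    (hb : ∀ j k l : ℕ, j + k + l = n → -C ≤ f 0 j k l)
    (hs : ∀ i j k l : ℕ, j + k + l = n →
      α * (c * ((i : ℝ) + 1) - C) + c * (k * μ1 + l * μ2)
      + j * (μ0 * min (f (i + 1) (j - 1) (k + 1) l) (f (i + 1) (j - 1) k (l + 1)))
      + k * (μ1 * f i (j + 1) (k - 1) l) + l * (μ2 * f i (j + 1) k (l - 1))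
      ≤ ((j : ℝ) * μ0 + k * μ1 + l * μ2 + α) * f (i + 1) j k l) :
    ∀ i j k l : ℕ, j + k + l = n → c * (i : ℝ) - C ≤ f i j k l := by
  have aux : ∀ (m : ℕ) (x y L : ℝ), 0 < x → (1 ≤ m → L ≤ y) → (m : ℝ) * (x * L) ≤ m * (x * y) := by
    intro m x y L hx h
    rcases Nat.eq_zero_or_pos m with hm | hm
    · subst hm; simp
    · have := h hm
      gcongr
  intro i
  induction i with
  | zero => intro j k l h; simpa using hb j k l h
  | succ i ih =>
    intro j
    induction j with
    | zero =>
      intro k l h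
      have H := hs i 0 k l h
      have h1 := aux k μ1 (f i (0 + 1) (k - 1) l) (c * i - C) hμ1 (fun h' => ih _ _ _ (by omega))
      have h2 := aux l μ2 (f i (0 + 1) k (l - 1)) (c * i - C) hμ2 (fun h' => ih _ _ _ (by omega))
      have hd' := hd 0 k l h
      push_cast at *
      refine le_of_mul_le_mul_left ?_ hd'
      linarith
    | succ j ihj =>
      intro k l h
      have H := hs i (j + 1) k l h
      have h1 := aux k μ1 (f i (j + 1 + 1) (k - 1) l) (c * i - C) hμ1
        (fun h' => ih _ _ _ (by omega))
      have h2 := aux l μ2 (f i (j + 1 + 1) k (l - 1)) (c * i - C) hμ2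
        (fun h' => ih _ _ _ (by omega))
      have h3 := aux (j + 1) μ0 (min (f (i + 1) (j + 1 - 1) (k + 1) l)
        (f (i + 1) (j + 1 - 1) k (l + 1))) (c * ((i + 1 : ℕ) : ℝ) - C) hμ0
        (fun _ => le_min (ihj _ _ (by omega)) (ihj _ _ (by omega)))
      have hd' := hd (j + 1) k l h
      push_cast at *
      refine le_of_mul_le_mul_left ?_ hd'
      linarith

theorem pos_rate (μ0 μ1 μ2 : ℝ) (hμ0 : 0 < μ0) (hμ1 : 0 < μ1) (hμ2 : 0 < μ2) (j k l : ℕ)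
    (h : 0 < j + k + l) : 0 < (j : ℝ) * μ0 + k * μ1 + l * μ2 := by
  rcases Nat.eq_zero_or_pos j with hj | hj
  · rcases Nat.eq_zero_or_pos k with hk | hk
    · have : 0 < l := by omega
      positivity
    · positivity
  · positivity

theorem rate_le (μ1 μ2 c : ℝ) (hμ1 : 0 < μ1) (hμ2 : 0 < μ2) (hc : 0 < c) (n j k l : ℕ)
    (h : j + k + l = n) : c * ((k : ℝ) * μ1 + l * μ2) ≤ c * (n * (μ1 + μ2)) := by
  have h1 : (k : ℝ) ≤ n := by exact_mod_cast (by omega : k ≤ n)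
  have h2 : (l : ℝ) ≤ n := by exact_mod_cast (by omega : l ≤ n)
  have := mul_le_mul_of_nonneg_right h1 hμ1.le
  have := mul_le_mul_of_nonneg_right h2 hμ2.le
  apply mul_le_mul_of_nonneg_left _ hc.le
  linarith

/-- weighted version of `min_sub` -/
theorem wmin_sub (m : ℕ) (x a b c d a' b' : ℝ) (hx : 0 < x) (ha : 1 ≤ m → a' = a - c)
    (hb : 1 ≤ m → b' = b - d) :
    (m : ℝ) * (x * min a' b') ≤ m * (x * min a b) - m * (x * min c d) := by
  rcases Nat.eq_zero_or_pos m with hm | hm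
  · subst hm; simp
  · rw [ha hm, hb hm]
    have := min_sub a b c d
    calc (m : ℝ) * (x * min (a - c) (b - d)) ≤ m * (x * (min a b - min c d)) := by gcongr
      _ = _ := by ring

theorem w_sub (m : ℕ) (x a c a' : ℝ) (ha : 1 ≤ m → a' = a - c) :
    (m : ℝ) * (x * a') = m * (x * a) - m * (x * c) := by
  rcases Nat.eq_zero_or_pos m with hm | hm
  · subst hm; simp
  · rw [ha hm]; ring

section
variable (Cp CG : ℕ) (μ0 μ1 μ2 h0 h1 h2 : ℝ)

theorem delta_growth (hCp : 0 < Cp) (hCpCG : Cp ≤ CG)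
    (hμ0 : 0 < μ0) (hμ1 : 0 < μ1) (hμ2 : 0 < μ2) (hh0 : 0 < h0) :
    ∃ c C : ℝ, 0 < c ∧ ∀ i j k l : ℕ, j + k + l = Cp → c * (i : ℝ) - C ≤
      v μ0 μ1 μ2 h0 h1 h2 CG (i + 1) j k l - v μ0 μ1 μ2 h0 h1 h2 CG i j k l := by
  obtain ⟨C, hC, hb⟩ := base_bound Cp (fun j k l =>
    v μ0 μ1 μ2 h0 h1 h2 CG (0 + 1) j k l - v μ0 μ1 μ2 h0 h1 h2 CG 0 j k l)
  have hCp' : (0 : ℝ) < Cp := by exact_mod_cast hCp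
  have hc : 0 < h0 / (Cp * (μ1 + μ2)) := by positivity
  have hcc : h0 / (Cp * (μ1 + μ2)) * (Cp * (μ1 + μ2)) = h0 := by field_simp
  refine ⟨h0 / (Cp * (μ1 + μ2)), C, hc, ?_⟩
  generalize h0 / (Cp * (μ1 + μ2)) = c at hc hcc
  refine growth μ0 μ1 μ2 0 c C Cp (fun i j k l =>
    v μ0 μ1 μ2 h0 h1 h2 CG (i + 1) j k l - v μ0 μ1 μ2 h0 h1 h2 CG i j k l) hμ0 hμ1 hμ2
    (fun j k l h => by
      have := pos_rate μ0 μ1 μ2 hμ0 hμ1 hμ2 j k l (by omega)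
      linarith) hb ?_
  intro i j k l h
  have hp := pos_rate μ0 μ1 μ2 hμ0 hμ1 hμ2 j k l (by omega)
  have hr := rate_le μ1 μ2 c hμ1 hμ2 hc Cp j k l h
  have eA := v_succ μ0 μ1 μ2 h0 h1 h2 CG (i + 1) j k l hp (by omega)
  have eB := v_succ μ0 μ1 μ2 h0 h1 h2 CG i j k l hp (by omega)
  have hm := wmin_sub j μ0 _ _ _ _ _ _ hμ0
    (fun _ => (rfl : _ = v μ0 μ1 μ2 h0 h1 h2 CG (i + 1 + 1) (j - 1) (k + 1) l -
      v μ0 μ1 μ2 h0 h1 h2 CG (i + 1) (j - 1) (k + 1) l))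
    (fun _ => (rfl : _ = v μ0 μ1 μ2 h0 h1 h2 CG (i + 1 + 1) (j - 1) k (l + 1) -
      v μ0 μ1 μ2 h0 h1 h2 CG (i + 1) (j - 1) k (l + 1)))
  push_cast at eA
  linarith

theorem e_growth (hCp : 0 < Cp) (hCpCG : Cp ≤ CG)
    (hμ0 : 0 < μ0) (hμ1 : 0 < μ1) (hμ2 : 0 < μ2) (hh0 : 0 < h0) (hh1 : 0 < h1) :
    ∃ c C : ℝ, 0 < c ∧ ∀ i j k l : ℕ, j + k + l = Cp - 1 → c * (i : ℝ) - C ≤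
      v μ0 μ1 μ2 h0 h1 h2 CG (i + 1) j (k + 1) l - v μ0 μ1 μ2 h0 h1 h2 CG i (j + 1) k l := by
  obtain ⟨c1, C1, hc1, hΔ⟩ := delta_growth Cp CG μ0 μ1 μ2 h0 h1 h2 hCp hCpCG hμ0 hμ1 hμ2 hh0
  obtain ⟨C0, hC0, hb⟩ := base_bound (Cp - 1) (fun j k l =>
    v μ0 μ1 μ2 h0 h1 h2 CG (0 + 1) j (k + 1) l - v μ0 μ1 μ2 h0 h1 h2 CG 0 (j + 1) k l)
  have hc : 0 < c1 * μ0 / (μ0 + μ1) := by positivity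
  have hcc : c1 * μ0 / (μ0 + μ1) * (μ0 + μ1) = c1 * μ0 := by field_simp
  generalize c1 * μ0 / (μ0 + μ1) = c at hc hcc
  obtain ⟨C, hCC0, hC⟩ : ∃ C : ℝ, C0 ≤ C ∧
      c * ((Cp - 1 : ℕ) * (μ1 + μ2)) + μ0 * C1 ≤ C * (μ0 + μ1) :=
    ⟨max C0 ((c * ((Cp - 1 : ℕ) * (μ1 + μ2)) + μ0 * C1) / (μ0 + μ1)), le_max_left _ _,
      (div_le_iff₀ (by positivity)).1 (le_max_right _ _)⟩
  refine ⟨c, C, hc, ?_⟩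
  refine growth μ0 μ1 μ2 (μ0 + μ1) c C (Cp - 1) (fun i j k l =>
    v μ0 μ1 μ2 h0 h1 h2 CG (i + 1) j (k + 1) l - v μ0 μ1 μ2 h0 h1 h2 CG i (j + 1) k l)
    hμ0 hμ1 hμ2 (fun j k l h => by positivity)
    (fun j k l h => le_trans (neg_le_neg hCC0) (hb j k l h)) ?_
  intro i j k l h
  have hr := rate_le μ1 μ2 c hμ1 hμ2 hc (Cp - 1) j k l h
  have eA := v_succ μ0 μ1 μ2 h0 h1 h2 CG (i + 1) j (k + 1) l
    (pos_rate μ0 μ1 μ2 hμ0 hμ1 hμ2 _ _ _ (by omega)) (by omega)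
  have eB := v_succ μ0 μ1 μ2 h0 h1 h2 CG i (j + 1) k l
    (pos_rate μ0 μ1 μ2 hμ0 hμ1 hμ2 _ _ _ (by omega)) (by omega)
  have hD := mul_le_mul_of_nonneg_left (hΔ (i + 1) j (k + 1) l (by omega)) hμ0.le
  simp only [Nat.add_sub_cancel] at eA eB
  have hm1 := mul_le_mul_of_nonneg_left (min_le_left (v μ0 μ1 μ2 h0 h1 h2 CG (i + 1) j (k + 1) l)
    (v μ0 μ1 μ2 h0 h1 h2 CG (i + 1) j k (l + 1))) hμ0.le
  have hm := wmin_sub j μ0 (v μ0 μ1 μ2 h0 h1 h2 CG (i + 1 + 1) (j - 1) (k + 1 + 1) l)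
    (v μ0 μ1 μ2 h0 h1 h2 CG (i + 1 + 1) (j - 1) (k + 1) (l + 1))
    (v μ0 μ1 μ2 h0 h1 h2 CG (i + 1) j (k + 1) l)
    (v μ0 μ1 μ2 h0 h1 h2 CG (i + 1) j k (l + 1))
    (v μ0 μ1 μ2 h0 h1 h2 CG (i + 1 + 1) (j - 1) (k + 1 + 1) l -
      v μ0 μ1 μ2 h0 h1 h2 CG (i + 1) (j - 1 + 1) (k + 1) l)
    (v μ0 μ1 μ2 h0 h1 h2 CG (i + 1 + 1) (j - 1) (k + 1) (l + 1) -
      v μ0 μ1 μ2 h0 h1 h2 CG (i + 1) (j - 1 + 1) k (l + 1)) hμ0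
    (fun hj => by rw [Nat.sub_add_cancel hj]) (fun hj => by rw [Nat.sub_add_cancel hj])
  have hk := w_sub k μ1 (v μ0 μ1 μ2 h0 h1 h2 CG (i + 1) (j + 1) k l)
    (v μ0 μ1 μ2 h0 h1 h2 CG i (j + 1 + 1) (k - 1) l)
    (v μ0 μ1 μ2 h0 h1 h2 CG (i + 1) (j + 1) (k - 1 + 1) l -
      v μ0 μ1 μ2 h0 h1 h2 CG i (j + 1 + 1) (k - 1) l)
    (fun hj => by rw [Nat.sub_add_cancel hj])
  push_cast at eA eB hD
  have hcc' : c * (μ0 + μ1) * ((i : ℝ) + 1) = c1 * μ0 * ((i : ℝ) + 1) := by rw [hcc]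
  linarith

theorem d_growth (hCp : 0 < Cp) (hCpCG : Cp ≤ CG)
    (hμ0 : 0 < μ0) (hμ1 : 0 < μ1) (hμ2 : 0 < μ2) (hh0 : 0 < h0) (hh1 : 0 < h1) (hμ : μ1 < μ2) :
    ∃ c C : ℝ, 0 < c ∧ ∀ i j k l : ℕ, j + k + l = Cp - 1 → c * (i : ℝ) - C ≤
      v μ0 μ1 μ2 h0 h1 h2 CG i j (k + 1) l - v μ0 μ1 μ2 h0 h1 h2 CG i j k (l + 1) := by
  obtain ⟨c1, C1, hc1, hE⟩ := e_growth Cp CG μ0 μ1 μ2 h0 h1 h2 hCp hCpCG hμ0 hμ1 hμ2 hh0 hh1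
  obtain ⟨C0, hC0, hb⟩ := base_bound (Cp - 1) (fun j k l =>
    v μ0 μ1 μ2 h0 h1 h2 CG 0 j (k + 1) l - v μ0 μ1 μ2 h0 h1 h2 CG 0 j k (l + 1))
  have hμ' : 0 < μ2 - μ1 := by linarith
  have hc : 0 < c1 * (μ2 - μ1) / μ2 := by positivity
  have hcc : c1 * (μ2 - μ1) / μ2 * μ2 = c1 * (μ2 - μ1) := by field_simp
  generalize c1 * (μ2 - μ1) / μ2 = c at hc hcc
  obtain ⟨C, hCC0, hC⟩ : ∃ C : ℝ, C0 ≤ C ∧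
      c * ((Cp - 1 : ℕ) * (μ1 + μ2)) + (μ2 - μ1) * C1 + h2 - h1 + c * μ2 ≤ C * μ2 :=
    ⟨max C0 ((c * ((Cp - 1 : ℕ) * (μ1 + μ2)) + (μ2 - μ1) * C1 + h2 - h1 + c * μ2) / μ2),
      le_max_left _ _, (div_le_iff₀ (by positivity)).1 (le_max_right _ _)⟩
  refine ⟨c, C, hc, ?_⟩
  refine growth μ0 μ1 μ2 μ2 c C (Cp - 1) (fun i j k l =>
    v μ0 μ1 μ2 h0 h1 h2 CG i j (k + 1) l - v μ0 μ1 μ2 h0 h1 h2 CG i j k (l + 1))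
    hμ0 hμ1 hμ2 (fun j k l h => by positivity)
    (fun j k l h => le_trans (neg_le_neg hCC0) (hb j k l h)) ?_
  intro i j k l h
  have hr := rate_le μ1 μ2 c hμ1 hμ2 hc (Cp - 1) j k l h
  have eA := v_succ μ0 μ1 μ2 h0 h1 h2 CG i j (k + 1) l
    (pos_rate μ0 μ1 μ2 hμ0 hμ1 hμ2 _ _ _ (by omega)) (by omega)
  have eB := v_succ μ0 μ1 μ2 h0 h1 h2 CG i j k (l + 1)
    (pos_rate μ0 μ1 μ2 hμ0 hμ1 hμ2 _ _ _ (by omega)) (by omega)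
  have hD := mul_le_mul_of_nonneg_left (hE i j k l h) hμ'.le
  simp only [Nat.add_sub_cancel] at eA eB
  have hm := wmin_sub j μ0 _ _ _ _ _ _ hμ0
    (fun _ => (rfl : _ = v μ0 μ1 μ2 h0 h1 h2 CG (i + 1) (j - 1) (k + 1 + 1) l -
      v μ0 μ1 μ2 h0 h1 h2 CG (i + 1) (j - 1) (k + 1) (l + 1)))
    (fun _ => (rfl : _ = v μ0 μ1 μ2 h0 h1 h2 CG (i + 1) (j - 1) (k + 1) (l + 1) -
      v μ0 μ1 μ2 h0 h1 h2 CG (i + 1) (j - 1) k (l + 1 + 1)))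
  have hk := w_sub k μ1 (v μ0 μ1 μ2 h0 h1 h2 CG i (j + 1) k l)
    (v μ0 μ1 μ2 h0 h1 h2 CG i (j + 1) (k - 1) (l + 1))
    (v μ0 μ1 μ2 h0 h1 h2 CG i (j + 1) (k - 1 + 1) l -
      v μ0 μ1 μ2 h0 h1 h2 CG i (j + 1) (k - 1) (l + 1))
    (fun hj => by rw [Nat.sub_add_cancel hj])
  have hl := w_sub l μ2 (v μ0 μ1 μ2 h0 h1 h2 CG i (j + 1) (k + 1) (l - 1))
    (v μ0 μ1 μ2 h0 h1 h2 CG i (j + 1) k l)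
    (v μ0 μ1 μ2 h0 h1 h2 CG i (j + 1) (k + 1) (l - 1) -
      v μ0 μ1 μ2 h0 h1 h2 CG i (j + 1) k (l - 1 + 1))
    (fun hj => by rw [Nat.sub_add_cancel hj])
  push_cast at eA eB
  have hcc' : c * μ2 * (i : ℝ) = c1 * (μ2 - μ1) * (i : ℝ) := by rw [hcc]
  linarith

end

theorem stmt9 (Cp CG : ℕ) (μ0 μ1 μ2 h0 h1 h2 : ℝ)
    (hCp : 0 < Cp) (hCG : 0 < CG) (hCpCG : Cp ≤ CG)
    (hμ0 : 0 < μ0) (hμ1 : 0 < μ1) (hμ2 : 0 < μ2)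
    (hh0 : 0 < h0) (hh1 : 0 < h1) (hh2 : 0 < h2)
    (hq : h1 / μ1 ≤ h2 / μ2) (hμ : μ1 < μ2) :
    ∀ j k l : ℕ, 1 ≤ j → j + k + l = Cp →
      ∃ N : ℕ, ∀ i : ℕ, N ≤ i →
        0 ≤ v μ0 μ1 μ2 h0 h1 h2 CG i (j - 1) (k + 1) l - v μ0 μ1 μ2 h0 h1 h2 CG i (j - 1) k (l + 1) := by
  intro j k l hj hsum
  obtain ⟨c, C, hc, hD⟩ := d_growth Cp CG μ0 μ1 μ2 h0 h1 h2 hCp hCpCG hμ0 hμ1 hμ2 hh0 hh1 hμ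
  obtain ⟨N, hN⟩ := exists_nat_ge (C / c)
  refine ⟨N, fun i hi => le_trans ?_ (hD i (j - 1) k l (by omega))⟩
  have hi' : (N : ℝ) ≤ i := by exact_mod_cast hi
  have := (div_le_iff₀ hc).1 (hN.trans hi')
  linarith
end

section
/- Suppose CG < Cp. For every (j,k,l) ∈ ℕ³ with j+k+l < Cp (so that (0,j,k,l), (0,j,k+1,l) ∈ X), one has v(0,j,k+1,l) − v(0,j,k,l) ≥ h1/μ1. -/
/-- The balance equation at `i = 0`, without guards. -/
theorem v_zero_eq (CG : ℕ) (μ0 μ1 μ2 h0 h1 h2 : ℝ) (hCG : 0 < CG)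
    (hμ0 : 0 < μ0) (hμ1 : 0 < μ1) (hμ2 : 0 < μ2) (j k l : ℕ) :
    ((j : ℝ) * μ0 + (k : ℝ) * μ1 + ((min l CG : ℕ) : ℝ) * μ2) * v μ0 μ1 μ2 h0 h1 h2 CG 0 j k l
      = (j : ℝ) * h0 + (k : ℝ) * h1 + (l : ℝ) * h2
        + (j : ℝ) * μ0 * min (v μ0 μ1 μ2 h0 h1 h2 CG 0 (j - 1) (k + 1) l)
                (v μ0 μ1 μ2 h0 h1 h2 CG 0 (j - 1) k (l + 1))
        + (k : ℝ) * μ1 * v μ0 μ1 μ2 h0 h1 h2 CG 0 j (k - 1) l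
        + ((min l CG : ℕ) : ℝ) * μ2 * v μ0 μ1 μ2 h0 h1 h2 CG 0 j k (l - 1) := by
  by_cases hz : j = 0 ∧ k = 0 ∧ l = 0
  · obtain ⟨rfl, rfl, rfl⟩ := hz
    simp
  · have hd : 0 < (j : ℝ) * μ0 + (k : ℝ) * μ1 + ((min l CG : ℕ) : ℝ) * μ2 := by
      have a1 : 0 ≤ (j : ℝ) * μ0 := by positivity
      have a2 : 0 ≤ (k : ℝ) * μ1 := by positivity
      have a3 : 0 ≤ ((min l CG : ℕ) : ℝ) * μ2 := by positivity
      have hc : 0 < j ∨ 0 < k ∨ 0 < min l CG := by omega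
      rcases hc with h | h | h
      · have : 0 < (j : ℝ) * μ0 := mul_pos (by exact_mod_cast h) hμ0
        linarith
      · have : 0 < (k : ℝ) * μ1 := mul_pos (by exact_mod_cast h) hμ1
        linarith
      · have : 0 < ((min l CG : ℕ) : ℝ) * μ2 := mul_pos (by exact_mod_cast h) hμ2
        linarith
    conv_lhs => rw [v.eq_2 _ _ _ _ _ _ _ _ _ _ (by intro a b c; exact hz ⟨a, b, c⟩)]
    rw [dRate, mul_div_cancel₀ _ hd.ne']
    congr 1
    · congr 1
      · congr 1
        rcases Nat.eq_zero_or_pos j with h | h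
        · simp [h]
        · rw [dif_pos (Nat.succ_le_of_lt h)]
      · rcases Nat.eq_zero_or_pos k with h | h
        · simp [h]
        · rw [dif_pos (Nat.succ_le_of_lt h)]
    · rcases Nat.eq_zero_or_pos l with h | h
      · simp [h]
      · rw [dif_pos (Nat.succ_le_of_lt h)]

/-- The bound on the increments in `k`, by induction on `2 j + k + l`. -/
theorem v_incr (CG : ℕ) (μ0 μ1 μ2 h0 h1 h2 : ℝ) (hCG : 0 < CG)
    (hμ0 : 0 < μ0) (hμ1 : 0 < μ1) (hμ2 : 0 < μ2) (n : ℕ) :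
    ∀ j k l : ℕ, 2 * j + k + l = n →
      v μ0 μ1 μ2 h0 h1 h2 CG 0 j k l + h1 / μ1 ≤ v μ0 μ1 μ2 h0 h1 h2 CG 0 j (k + 1) l := by
  induction n using Nat.strong_induction_on with
  | _ n ih =>
  intro j k l hn
  have e1 := v_zero_eq CG μ0 μ1 μ2 h0 h1 h2 hCG hμ0 hμ1 hμ2 j k l
  have e2 := v_zero_eq CG μ0 μ1 μ2 h0 h1 h2 hCG hμ0 hμ1 hμ2 j (k + 1) l
  simp only [Nat.add_sub_cancel] at e2
  push_cast [-Nat.cast_min] at e2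
  have a1 : 0 ≤ (j : ℝ) * μ0 := by positivity
  have a2 : 0 ≤ (k : ℝ) * μ1 := by positivity
  have a3 : 0 ≤ ((min l CG : ℕ) : ℝ) * μ2 := by positivity
  have b1 : (j : ℝ) * μ0 * (min (v μ0 μ1 μ2 h0 h1 h2 CG 0 (j - 1) (k + 1) l)
                (v μ0 μ1 μ2 h0 h1 h2 CG 0 (j - 1) k (l + 1)) + h1 / μ1)
      ≤ (j : ℝ) * μ0 * min (v μ0 μ1 μ2 h0 h1 h2 CG 0 (j - 1) (k + 1 + 1) l)
                (v μ0 μ1 μ2 h0 h1 h2 CG 0 (j - 1) (k + 1) (l + 1)) := by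
    rcases Nat.eq_zero_or_pos j with h | h
    · simp [h]
    · apply mul_le_mul_of_nonneg_left _ a1
      rw [← min_add_add_right]
      exact min_le_min (ih _ (by omega) (j - 1) (k + 1) l rfl)
        (ih _ (by omega) (j - 1) k (l + 1) rfl)
  have b2 : (k : ℝ) * μ1 * (v μ0 μ1 μ2 h0 h1 h2 CG 0 j (k - 1) l + h1 / μ1)
      ≤ (k : ℝ) * μ1 * v μ0 μ1 μ2 h0 h1 h2 CG 0 j k l := by
    rcases Nat.eq_zero_or_pos k with h | h
    · simp [h]
    · apply mul_le_mul_of_nonneg_left _ a2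
      have := ih _ (by omega) j (k - 1) l rfl
      rwa [Nat.sub_add_cancel h] at this
  have b3 : ((min l CG : ℕ) : ℝ) * μ2 * (v μ0 μ1 μ2 h0 h1 h2 CG 0 j k (l - 1) + h1 / μ1)
      ≤ ((min l CG : ℕ) : ℝ) * μ2 * v μ0 μ1 μ2 h0 h1 h2 CG 0 j (k + 1) (l - 1) := by
    rcases Nat.eq_zero_or_pos l with h | h
    · simp [h]
    · apply mul_le_mul_of_nonneg_left _ a3
      exact ih _ (by omega) j k (l - 1) rfl
  have hq : μ1 * (h1 / μ1) = h1 := by field_simp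
  have hd : 0 < (j : ℝ) * μ0 + ((k : ℝ) + 1) * μ1 + ((min l CG : ℕ) : ℝ) * μ2 := by linarith
  refine le_of_mul_le_mul_left ?_ hd
  linarith

theorem stmt10 (Cp CG : ℕ) (μ0 μ1 μ2 h0 h1 h2 : ℝ)
    (hCp : 0 < Cp) (hCG : 0 < CG) (hCpCG : CG < Cp)
    (hμ0 : 0 < μ0) (hμ1 : 0 < μ1) (hμ2 : 0 < μ2)
    (hh0 : 0 < h0) (hh1 : 0 < h1) (hh2 : 0 < h2)
    : ∀ j k l : ℕ, j + k + l < Cp →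
      h1 / μ1 ≤ v μ0 μ1 μ2 h0 h1 h2 CG 0 j (k + 1) l - v μ0 μ1 μ2 h0 h1 h2 CG 0 j k l := by
  intro j k l _
  have := v_incr CG μ0 μ1 μ2 h0 h1 h2 hCG hμ0 hμ1 hμ2 _ j k l rfl
  linarith
end

section
/- Suppose CG < Cp. For every (j,k,l) ∈ ℕ³ with j+k+l < Cp (so that (0,j,k,l), (0,j,k,l+1) ∈ X), one has v(0,j,k,l+1) − v(0,j,k,l) ≥ h2/μ2. -/
theorem v_eq_aux (μ0 μ1 μ2 h0 h1 h2 : ℝ) (CG : ℕ) (hCG : 0 < CG)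
    (hμ0 : 0 < μ0) (hμ1 : 0 < μ1) (hμ2 : 0 < μ2) (j k l : ℕ) :
    dRate μ0 μ1 μ2 CG j k l * v μ0 μ1 μ2 h0 h1 h2 CG 0 j k l =
      (j : ℝ) * h0 + (k : ℝ) * h1 + (l : ℝ) * h2
      + (j : ℝ) * μ0 *
            min (v μ0 μ1 μ2 h0 h1 h2 CG 0 (j - 1) (k + 1) l)
                (v μ0 μ1 μ2 h0 h1 h2 CG 0 (j - 1) k (l + 1))
      + (k : ℝ) * μ1 * v μ0 μ1 μ2 h0 h1 h2 CG 0 j (k - 1) l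
      + ((min l CG : ℕ) : ℝ) * μ2 * v μ0 μ1 μ2 h0 h1 h2 CG 0 j k (l - 1) := by
  by_cases h : j = 0 ∧ k = 0 ∧ l = 0
  · obtain ⟨rfl, rfl, rfl⟩ := h
    simp [dRate]
  · have hd : 0 < dRate μ0 μ1 μ2 CG j k l := by
      unfold dRate
      rcases Nat.eq_zero_or_pos j with hj | hj
      · rcases Nat.eq_zero_or_pos k with hk | hk
        · have : 0 < min l CG := by omega
          have : (0 : ℝ) < ((min l CG : ℕ) : ℝ) := Nat.cast_pos.mpr this
          positivity
        · have : (0 : ℝ) < (k : ℝ) := Nat.cast_pos.mpr hk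
          positivity
      · have : (0 : ℝ) < (j : ℝ) := Nat.cast_pos.mpr hj
        positivity
    have e : v μ0 μ1 μ2 h0 h1 h2 CG 0 j k l = _ :=
      v.eq_2 μ0 μ1 μ2 h0 h1 h2 CG j k l (fun a b c => h ⟨a, b, c⟩)
    rw [e, mul_div_cancel₀ _ hd.ne']
    congr 1
    · congr 1
      · congr 1
        split_ifs with hj
        · rfl
        · have : j = 0 := by omega
          subst this; simp
      · split_ifs with hj
        · rfl
        · have : k = 0 := by omega
          subst this; simp
    · split_ifs with hj
      · rfl
      · have : l = 0 := by omega
        subst this; simp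

theorem v_main_aux (μ0 μ1 μ2 h0 h1 h2 : ℝ) (CG : ℕ) (hCG : 0 < CG)
    (hμ0 : 0 < μ0) (hμ1 : 0 < μ1) (hμ2 : 0 < μ2) (hh2 : 0 < h2) (n : ℕ) :
    ∀ j k l : ℕ, 2 * j + k + l = n →
      v μ0 μ1 μ2 h0 h1 h2 CG 0 j k l + h2 / μ2 ≤ v μ0 μ1 μ2 h0 h1 h2 CG 0 j k (l + 1) := by
  induction n using Nat.strong_induction_on with
  | _ n ih =>
  intro j k l hn
  have e1 := v_eq_aux μ0 μ1 μ2 h0 h1 h2 CG hCG hμ0 hμ1 hμ2 j k l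
  have e2 := v_eq_aux μ0 μ1 μ2 h0 h1 h2 CG hCG hμ0 hμ1 hμ2 j k (l + 1)
  have hc : h2 = μ2 * (h2 / μ2) := by field_simp
  have hcpos : 0 < h2 / μ2 := by positivity
  have hd : 0 < dRate μ0 μ1 μ2 CG j k (l + 1) := by
    unfold dRate
    have : 0 < min (l + 1) CG := by omega
    have : (0 : ℝ) < ((min (l + 1) CG : ℕ) : ℝ) := Nat.cast_pos.mpr this
    positivity
  generalize hcdef : h2 / μ2 = c at *
  set f := v μ0 μ1 μ2 h0 h1 h2 CG 0 with hf
  have t1 : (j : ℝ) * μ0 * (min (f (j - 1) (k + 1) l) (f (j - 1) k (l + 1)) + c) ≤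
      (j : ℝ) * μ0 * min (f (j - 1) (k + 1) (l + 1)) (f (j - 1) k (l + 1 + 1)) := by
    rcases Nat.eq_zero_or_pos j with hj | hj
    · subst hj; simp
    · apply mul_le_mul_of_nonneg_left _ (by positivity)
      rw [← min_add_add_right]
      exact min_le_min (ih _ (by omega) _ _ _ rfl) (ih _ (by omega) _ _ _ rfl)
  have t2 : (k : ℝ) * μ1 * (f j (k - 1) l + c) ≤ (k : ℝ) * μ1 * f j (k - 1) (l + 1) := by
    rcases Nat.eq_zero_or_pos k with hj | hj
    · subst hj; simp
    · exact mul_le_mul_of_nonneg_left (ih _ (by omega) _ _ _ rfl) (by positivity)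
  have t3 : ((min l CG : ℕ) : ℝ) * μ2 * (f j k (l - 1) + c) ≤
      ((min l CG : ℕ) : ℝ) * μ2 * f j k l := by
    rcases Nat.eq_zero_or_pos l with hj | hj
    · subst hj; simp
    · apply mul_le_mul_of_nonneg_left _ (by positivity)
      have := ih _ (by omega) j k (l - 1) rfl
      rwa [Nat.sub_add_cancel hj] at this
  apply le_of_mul_le_mul_left _ hd
  rw [mul_add, e2]
  simp only [Nat.add_sub_cancel]
  rcases Nat.lt_or_ge l CG with hl | hl
  · have m1 : min l CG = l := by omega
    have m2 : min (l + 1) CG = l + 1 := by omega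
    unfold dRate at *
    rw [m1] at e1 t3
    rw [m2]
    push_cast
    nlinarith
  · have m1 : min l CG = CG := by omega
    have m2 : min (l + 1) CG = CG := by omega
    unfold dRate at *
    rw [m1] at e1 t3
    rw [m2]
    push_cast
    nlinarith

theorem stmt11 (Cp CG : ℕ) (μ0 μ1 μ2 h0 h1 h2 : ℝ)
    (hCp : 0 < Cp) (hCG : 0 < CG) (hCpCG : CG < Cp)
    (hμ0 : 0 < μ0) (hμ1 : 0 < μ1) (hμ2 : 0 < μ2)
    (hh0 : 0 < h0) (hh1 : 0 < h1) (hh2 : 0 < h2)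
    : ∀ j k l : ℕ, j + k + l < Cp →
      h2 / μ2 ≤ v μ0 μ1 μ2 h0 h1 h2 CG 0 j k (l + 1) - v μ0 μ1 μ2 h0 h1 h2 CG 0 j k l := by
  intro j k l _
  have := v_main_aux μ0 μ1 μ2 h0 h1 h2 CG hCG hμ0 hμ1 hμ2 hh2 _ j k l rfl
  linarith
end

section
/- Suppose CG < Cp. For every (j,k,l) ∈ ℕ³ with j+k+l < Cp (so that (0,j,k,l), (0,j+1,k,l) ∈ X), one has v(0,j+1,k,l) − v(0,j,k,l) ≥ h0/μ0 + min(h1/μ1, h2/μ2). -/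
/-- The recursion at `i = 0`, multiplied out and without guards. -/
theorem v_eq (CG : ℕ) (μ0 μ1 μ2 h0 h1 h2 : ℝ) (hCG : 0 < CG)
    (hμ0 : 0 < μ0) (hμ1 : 0 < μ1) (hμ2 : 0 < μ2) (j k l : ℕ) :
    ((j : ℝ) * μ0 + (k : ℝ) * μ1 + ((min l CG : ℕ) : ℝ) * μ2) * v μ0 μ1 μ2 h0 h1 h2 CG 0 j k l =
      (j : ℝ) * h0 + (k : ℝ) * h1 + (l : ℝ) * h2
      + (j : ℝ) * (μ0 *
            min (v μ0 μ1 μ2 h0 h1 h2 CG 0 (j - 1) (k + 1) l)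
                (v μ0 μ1 μ2 h0 h1 h2 CG 0 (j - 1) k (l + 1)))
      + (k : ℝ) * (μ1 * v μ0 μ1 μ2 h0 h1 h2 CG 0 j (k - 1) l)
      + ((min l CG : ℕ) : ℝ) * (μ2 * v μ0 μ1 μ2 h0 h1 h2 CG 0 j k (l - 1)) := by
  by_cases hz : j = 0 ∧ k = 0 ∧ l = 0
  · obtain ⟨rfl, rfl, rfl⟩ := hz
    simp
  · have hd : 0 < (j : ℝ) * μ0 + (k : ℝ) * μ1 + ((min l CG : ℕ) : ℝ) * μ2 := by
      have e1 : 0 ≤ (j : ℝ) * μ0 := by positivity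
      have e2 : 0 ≤ (k : ℝ) * μ1 := by positivity
      have e3 : 0 ≤ ((min l CG : ℕ) : ℝ) * μ2 := by positivity
      rcases Nat.eq_zero_or_pos j with hj | hj
      · rcases Nat.eq_zero_or_pos k with hk | hk
        · have hl : 0 < min l CG := by omega
          have : 0 < ((min l CG : ℕ) : ℝ) * μ2 := mul_pos (Nat.cast_pos.mpr hl) hμ2
          linarith
        · have : 0 < (k : ℝ) * μ1 := by positivity
          linarith
      · have : 0 < (j : ℝ) * μ0 := by positivity
        linarith
    rw [v.eq_2 _ _ _ _ _ _ _ _ _ _ (by tauto), dRate, mul_div_cancel₀ _ hd.ne']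
    have a1 : ¬ 1 ≤ j → (j : ℝ) = 0 := fun h => by
      have : j = 0 := by omega
      simp [this]
    have a2 : ¬ 1 ≤ k → (k : ℝ) = 0 := fun h => by
      have : k = 0 := by omega
      simp [this]
    have a3 : ¬ 1 ≤ l → ((min l CG : ℕ) : ℝ) = 0 := fun h => by
      have : l = 0 := by omega
      simp [this]
    congr 1
    · congr 1
      · congr 1
        split_ifs with h
        · ring
        · rw [a1 h, zero_mul]
      · split_ifs with h
        · ring
        · rw [a2 h, zero_mul]
    · split_ifs with h
      · ring
      · rw [a3 h, zero_mul]

/-- Everything at once for an abstract solution of the recursion. -/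
theorem abs_main (CG : ℕ) (μ0 μ1 μ2 h0 h1 h2 a b : ℝ) (hCG : 0 < CG)
    (hμ0 : 0 < μ0) (hμ1 : 0 < μ1) (hμ2 : 0 < μ2) (hh2 : 0 < h2)
    (ha : h1 = μ1 * a) (hb : h2 = μ2 * b) (c : ℝ) (hc : μ0 * c = h0 + μ0 * min a b)
    (f : ℕ → ℕ → ℕ → ℝ)
    (hf : ∀ j k l : ℕ,
      ((j : ℝ) * μ0 + (k : ℝ) * μ1 + ((min l CG : ℕ) : ℝ) * μ2) * f j k l =
      (j : ℝ) * h0 + (k : ℝ) * h1 + (l : ℝ) * h2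
      + (j : ℝ) * (μ0 * min (f (j - 1) (k + 1) l) (f (j - 1) k (l + 1)))
      + (k : ℝ) * (μ1 * f j (k - 1) l)
      + ((min l CG : ℕ) : ℝ) * (μ2 * f j k (l - 1))) (n : ℕ) :
    ∀ j k l : ℕ, 2 * j + k + l < n →
      f j (k + 1) l = f j k l + a ∧ f j k l + b ≤ f j k (l + 1) ∧ f j k l + c ≤ f (j + 1) k l := by
  induction n with
  | zero => intro j k l h; omega
  | succ n ih =>
    intro j k l hn
    have hj0 : (0 : ℝ) ≤ j := Nat.cast_nonneg j
    have hk0 : (0 : ℝ) ≤ k := Nat.cast_nonneg k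
    have hl0 : (0 : ℝ) ≤ ((min l CG : ℕ) : ℝ) := Nat.cast_nonneg _
    have hdn : 0 ≤ (j : ℝ) * μ0 + (k : ℝ) * μ1 + ((min l CG : ℕ) : ℝ) * μ2 := by positivity
    have e0 := hf j k l
    have A : f j (k + 1) l = f j k l + a := by
      have e1 := hf j (k + 1) l
      have t1 : (j : ℝ) * (μ0 * min (f (j - 1) (k + 1 + 1) l) (f (j - 1) (k + 1) (l + 1)))
          = (j : ℝ) * (μ0 * (min (f (j - 1) (k + 1) l) (f (j - 1) k (l + 1)) + a)) := by
        rcases Nat.eq_zero_or_pos j with h | h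
        · simp [h]
        · rw [(ih (j - 1) (k + 1) l (by omega)).1, (ih (j - 1) k (l + 1) (by omega)).1,
            min_add_add_right]
      have t2 : (k : ℝ) * (μ1 * f j k l) = (k : ℝ) * (μ1 * (f j (k - 1) l + a)) := by
        rcases Nat.eq_zero_or_pos k with h | h
        · simp [h]
        · have := (ih j (k - 1) l (by omega)).1
          rw [Nat.sub_add_cancel h] at this
          rw [this]
      have t3 : ((min l CG : ℕ) : ℝ) * (μ2 * f j (k + 1) (l - 1))
          = ((min l CG : ℕ) : ℝ) * (μ2 * (f j k (l - 1) + a)) := by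
        rcases Nat.eq_zero_or_pos l with h | h
        · simp [h]
        · rw [(ih j k (l - 1) (by omega)).1]
      rw [t1, t3, Nat.add_sub_cancel] at e1
      push_cast at e1 e0 t2 t3 hdn
      have hd : 0 < (j : ℝ) * μ0 + ((k : ℝ) + 1) * μ1 + (min (l : ℝ) CG) * μ2 := by linarith
      apply mul_left_cancel₀ hd.ne'
      linear_combination e1 - e0 + t2 + ha
    have B : f j k l + b ≤ f j k (l + 1) := by
      have e1 := hf j k (l + 1)
      have t1 : (j : ℝ) * (μ0 * (min (f (j - 1) (k + 1) l) (f (j - 1) k (l + 1)) + b))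
          ≤ (j : ℝ) * (μ0 * min (f (j - 1) (k + 1) (l + 1)) (f (j - 1) k (l + 1 + 1))) := by
        rcases Nat.eq_zero_or_pos j with h | h
        · simp [h]
        · have i1 := (ih (j - 1) (k + 1) l (by omega)).2.1
          have i2 := (ih (j - 1) k (l + 1) (by omega)).2.1
          rw [← min_add_add_right]
          gcongr
      have t2 : (k : ℝ) * (μ1 * (f j (k - 1) l + b)) ≤ (k : ℝ) * (μ1 * f j (k - 1) (l + 1)) := by
        rcases Nat.eq_zero_or_pos k with h | h
        · simp [h]
        · have := (ih j (k - 1) l (by omega)).2.1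
          gcongr
      have t3 : ((min l CG : ℕ) : ℝ) * (μ2 * (f j k (l - 1) + b))
          ≤ ((min l CG : ℕ) : ℝ) * (μ2 * f j k l) := by
        rcases Nat.eq_zero_or_pos l with h | h
        · simp [h]
        · have := (ih j k (l - 1) (by omega)).2.1
          rw [Nat.sub_add_cancel h] at this
          gcongr
      rw [Nat.add_sub_cancel] at e1
      rcases Nat.lt_or_ge l CG with hl | hl
      · rw [show min (l + 1) CG = l + 1 by omega] at e1
        rw [show min l CG = l by omega] at e0 t3 hdn
        push_cast at e1
        have hd : 0 < (j : ℝ) * μ0 + (k : ℝ) * μ1 + ((l : ℝ) + 1) * μ2 := by linarith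
        apply le_of_mul_le_mul_left _ hd
        linarith
      · rw [show min (l + 1) CG = CG by omega] at e1
        rw [show min l CG = CG by omega] at e0 t3 hdn
        push_cast at e1
        have hC : (0 : ℝ) < CG * μ2 := by positivity
        have hd : 0 < (j : ℝ) * μ0 + (k : ℝ) * μ1 + (CG : ℝ) * μ2 := by
          have : 0 ≤ (j : ℝ) * μ0 := by positivity
          have : 0 ≤ (k : ℝ) * μ1 := by positivity
          linarith
        apply le_of_mul_le_mul_left _ hd
        linarith
    refine ⟨A, B, ?_⟩
    have e1 := hf (j + 1) k l
    rw [Nat.add_sub_cancel] at e1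
    have t0 : μ0 * (f j k l + min a b) ≤ μ0 * min (f j (k + 1) l) (f j k (l + 1)) := by
      rw [← min_add_add_left, A]
      gcongr
    have t1 : (j : ℝ) * (μ0 * (min (f (j - 1) (k + 1) l) (f (j - 1) k (l + 1)) + c))
        ≤ (j : ℝ) * (μ0 * min (f j (k + 1) l) (f j k (l + 1))) := by
      rcases Nat.eq_zero_or_pos j with h | h
      · simp [h]
      · have i1 := (ih (j - 1) (k + 1) l (by omega)).2.2
        have i2 := (ih (j - 1) k (l + 1) (by omega)).2.2
        rw [Nat.sub_add_cancel h] at i1 i2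
        rw [← min_add_add_right]
        gcongr
    have t2 : (k : ℝ) * (μ1 * (f j (k - 1) l + c)) ≤ (k : ℝ) * (μ1 * f (j + 1) (k - 1) l) := by
      rcases Nat.eq_zero_or_pos k with h | h
      · simp [h]
      · have := (ih j (k - 1) l (by omega)).2.2
        gcongr
    have t3 : ((min l CG : ℕ) : ℝ) * (μ2 * (f j k (l - 1) + c))
        ≤ ((min l CG : ℕ) : ℝ) * (μ2 * f (j + 1) k (l - 1)) := by
      rcases Nat.eq_zero_or_pos l with h | h
      · simp [h]
      · have := (ih j k (l - 1) (by omega)).2.2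
        gcongr
    push_cast at e1 e0 t3 hdn
    have hd : 0 < ((j : ℝ) + 1) * μ0 + (k : ℝ) * μ1 + (min (l : ℝ) CG) * μ2 := by linarith
    apply le_of_mul_le_mul_left _ hd
    linarith

theorem stmt12 (Cp CG : ℕ) (μ0 μ1 μ2 h0 h1 h2 : ℝ)
    (hCp : 0 < Cp) (hCG : 0 < CG) (hCpCG : CG < Cp)
    (hμ0 : 0 < μ0) (hμ1 : 0 < μ1) (hμ2 : 0 < μ2)
    (hh0 : 0 < h0) (hh1 : 0 < h1) (hh2 : 0 < h2)
    : ∀ j k l : ℕ, j + k + l < Cp →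
      h0 / μ0 + min (h1 / μ1) (h2 / μ2) ≤
        v μ0 μ1 μ2 h0 h1 h2 CG 0 (j + 1) k l - v μ0 μ1 μ2 h0 h1 h2 CG 0 j k l := by
  intro j k l _
  have h := (abs_main CG μ0 μ1 μ2 h0 h1 h2 (h1 / μ1) (h2 / μ2) hCG hμ0 hμ1 hμ2 hh2
    (by field_simp) (by field_simp) (h0 / μ0 + min (h1 / μ1) (h2 / μ2))
    (by rw [mul_add, mul_div_cancel₀ _ hμ0.ne'])
    (fun j k l => v μ0 μ1 μ2 h0 h1 h2 CG 0 j k l)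
    (fun j k l => v_eq CG μ0 μ1 μ2 h0 h1 h2 hCG hμ0 hμ1 hμ2 j k l)
    (2 * j + k + l + 1) j k l (by omega)).2.2
  linarith
end

section
/- Suppose CG < Cp. For every (i,j,k,l) ∈ ℕ⁴ with i ≥ 0, j ≥ 1 and j+k+l = Cp, one has both v(i+1,j-1,k+1,l) − v(i,j,k,l) ≥ min(h1/μ1, h2/μ2) and v(i+1,j-1,k,l+1) − v(i,j,k,l) ≥ min(h1/μ1, h2/μ2). -/
theorem v_eq_zero (μ0 μ1 μ2 h0 h1 h2 : ℝ) (CG : ℕ) (hCG : 0 < CG)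
    (hμ0 : 0 < μ0) (hμ1 : 0 < μ1) (hμ2 : 0 < μ2) (j k l : ℕ) :
    ((j : ℝ) * μ0 + (k : ℝ) * μ1 + ((min l CG : ℕ) : ℝ) * μ2) * v μ0 μ1 μ2 h0 h1 h2 CG 0 j k l =
      (j : ℝ) * h0 + (k : ℝ) * h1 + (l : ℝ) * h2
      + (j : ℝ) * μ0 * min (v μ0 μ1 μ2 h0 h1 h2 CG 0 (j - 1) (k + 1) l)
                (v μ0 μ1 μ2 h0 h1 h2 CG 0 (j - 1) k (l + 1))
      + (k : ℝ) * μ1 * v μ0 μ1 μ2 h0 h1 h2 CG 0 j (k - 1) l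
      + ((min l CG : ℕ) : ℝ) * μ2 * v μ0 μ1 μ2 h0 h1 h2 CG 0 j k (l - 1) := by
  by_cases hz : j = 0 ∧ k = 0 ∧ l = 0
  · obtain ⟨rfl, rfl, rfl⟩ := hz
    simp
  · have hd : (j : ℝ) * μ0 + (k : ℝ) * μ1 + ((min l CG : ℕ) : ℝ) * μ2 ≠ 0 := by
      apply ne_of_gt
      have a1 : 0 ≤ (j : ℝ) * μ0 := by positivity
      have a2 : 0 ≤ (k : ℝ) * μ1 := by positivity
      have a3 : 0 ≤ ((min l CG : ℕ) : ℝ) * μ2 := by positivity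
      rcases Nat.eq_zero_or_pos j with hj | hj
      · rcases Nat.eq_zero_or_pos k with hk | hk
        · have hl : 0 < min l CG := by omega
          have : 0 < ((min l CG : ℕ) : ℝ) * μ2 := mul_pos (Nat.cast_pos.2 hl) hμ2
          linarith
        · have : 0 < (k : ℝ) * μ1 := by positivity
          linarith
      · have : 0 < (j : ℝ) * μ0 := by positivity
        linarith
    rw [v.eq_2 _ _ _ _ _ _ _ _ _ _ (by tauto), dRate, mul_div_cancel₀ _ hd]
    congr 1
    · congr 1
      · congr 1
        split_ifs with h
        · rfl
        · have : j = 0 := by omega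
          simp [this]
      · split_ifs with h
        · rfl
        · have : k = 0 := by omega
          simp [this]
    · split_ifs with h
      · rfl
      · have : l = 0 := by omega
        simp [this]

theorem v_eq_succ (μ0 μ1 μ2 h0 h1 h2 : ℝ) (CG : ℕ) (hCG : 0 < CG)
    (hμ0 : 0 < μ0) (hμ1 : 0 < μ1) (hμ2 : 0 < μ2) (i j k l : ℕ) (hp : 0 < j + k + l) :
    ((j : ℝ) * μ0 + (k : ℝ) * μ1 + ((min l CG : ℕ) : ℝ) * μ2) *
        v μ0 μ1 μ2 h0 h1 h2 CG (i + 1) j k l =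
      ((i : ℝ) + 1 + (j : ℝ)) * h0 + (k : ℝ) * h1 + (l : ℝ) * h2
      + (j : ℝ) * μ0 * min (v μ0 μ1 μ2 h0 h1 h2 CG (i + 1) (j - 1) (k + 1) l)
                (v μ0 μ1 μ2 h0 h1 h2 CG (i + 1) (j - 1) k (l + 1))
      + (k : ℝ) * μ1 * v μ0 μ1 μ2 h0 h1 h2 CG i (j + 1) (k - 1) l
      + ((min l CG : ℕ) : ℝ) * μ2 * v μ0 μ1 μ2 h0 h1 h2 CG i (j + 1) k (l - 1) := by
  have hd : (j : ℝ) * μ0 + (k : ℝ) * μ1 + ((min l CG : ℕ) : ℝ) * μ2 ≠ 0 := by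
    apply ne_of_gt
    have a1 : 0 ≤ (j : ℝ) * μ0 := by positivity
    have a2 : 0 ≤ (k : ℝ) * μ1 := by positivity
    have a3 : 0 ≤ ((min l CG : ℕ) : ℝ) * μ2 := by positivity
    rcases Nat.eq_zero_or_pos j with hj | hj
    · rcases Nat.eq_zero_or_pos k with hk | hk
      · have hl : 0 < min l CG := by omega
        have : 0 < ((min l CG : ℕ) : ℝ) * μ2 := mul_pos (Nat.cast_pos.2 hl) hμ2
        linarith
      · have : 0 < (k : ℝ) * μ1 := by positivity
        linarith
    · have : 0 < (j : ℝ) * μ0 := by positivity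
      linarith
  rw [v.eq_3, dRate, mul_div_cancel₀ _ hd]
  congr 1
  · congr 1
    · congr 1
      split_ifs with h
      · rfl
      · have : j = 0 := by omega
        simp [this]
    · split_ifs with h
      · rfl
      · have : k = 0 := by omega
        simp [this]
  · split_ifs with h
    · rfl
    · have : l = 0 := by omega
      simp [this]

theorem term_nonneg (c : ℕ) (μ A B m : ℝ) (hμ : 0 < μ) (h : 1 ≤ c → m ≤ A - B) :
    0 ≤ (c : ℝ) * μ * (A - B - m) := by
  rcases Nat.eq_zero_or_pos c with hc | hc
  · simp [hc]
  · have := h hc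
    have : 0 ≤ A - B - m := by linarith
    positivity

theorem le_min_sub_min (a b a' b' m : ℝ) (h : m ≤ a' - a) (h' : m ≤ b' - b) :
    m ≤ min a' b' - min a b := by
  rcases le_total a' b' with H | H
  · rw [min_eq_left H]
    linarith [min_le_left a b]
  · rw [min_eq_right H]
    linarith [min_le_right a b]

theorem le_of_scaled (d A B m : ℝ) (hd : 0 < d) (h : 0 ≤ d * (A - B - m)) : m ≤ A - B := by
  have := nonneg_of_mul_nonneg_right h hd
  linarith

/-- The coupling argument for a function satisfying the optimality equations. -/
theorem coupling (f : ℕ → ℕ → ℕ → ℕ → ℝ) (Cp CG : ℕ) (μ0 μ1 μ2 h0 h1 h2 m : ℝ)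
    (hCG : 0 < CG) (hμ0 : 0 < μ0) (hμ1 : 0 < μ1) (hμ2 : 0 < μ2)
    (hh0 : 0 < h0) (hm1 : m * μ1 ≤ h1) (hm2 : m * μ2 ≤ h2) (hm0 : 0 < h2)
    (e0 : ∀ j k l : ℕ, ((j : ℝ) * μ0 + (k : ℝ) * μ1 + ((min l CG : ℕ) : ℝ) * μ2) * f 0 j k l =
      (j : ℝ) * h0 + (k : ℝ) * h1 + (l : ℝ) * h2
      + (j : ℝ) * μ0 * min (f 0 (j - 1) (k + 1) l) (f 0 (j - 1) k (l + 1))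
      + (k : ℝ) * μ1 * f 0 j (k - 1) l
      + ((min l CG : ℕ) : ℝ) * μ2 * f 0 j k (l - 1))
    (eS : ∀ i j k l : ℕ, 0 < j + k + l →
      ((j : ℝ) * μ0 + (k : ℝ) * μ1 + ((min l CG : ℕ) : ℝ) * μ2) * f (i + 1) j k l =
      ((i : ℝ) + 1 + (j : ℝ)) * h0 + (k : ℝ) * h1 + (l : ℝ) * h2
      + (j : ℝ) * μ0 * min (f (i + 1) (j - 1) (k + 1) l) (f (i + 1) (j - 1) k (l + 1))
      + (k : ℝ) * μ1 * f i (j + 1) (k - 1) l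
      + ((min l CG : ℕ) : ℝ) * μ2 * f i (j + 1) k (l - 1)) :
    ∀ i j k l : ℕ, j + 1 + k + l = Cp →
      m ≤ f (i + 1) j (k + 1) l - f i (j + 1) k l ∧
      m ≤ f (i + 1) j k (l + 1) - f i (j + 1) k l := by
  have nn : ∀ (c : ℕ) (μ : ℝ), 0 < μ → 0 ≤ (c : ℝ) * μ := fun c μ h => by positivity
  have dpos : ∀ j k l : ℕ, 0 < j + k + l →
      0 < (j : ℝ) * μ0 + (k : ℝ) * μ1 + ((min l CG : ℕ) : ℝ) * μ2 := by
    intro j k l hp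
    have a1 := nn j μ0 hμ0
    have a2 := nn k μ1 hμ1
    have a3 := nn (min l CG) μ2 hμ2
    rcases Nat.eq_zero_or_pos j with hj | hj
    · rcases Nat.eq_zero_or_pos k with hk | hk
      · have hl : 0 < min l CG := by omega
        have : 0 < ((min l CG : ℕ) : ℝ) * μ2 := mul_pos (Nat.cast_pos.2 hl) hμ2
        linarith
      · have : 0 < (k : ℝ) * μ1 := by positivity
        linarith
    · have : 0 < (j : ℝ) * μ0 := by positivity
      linarith
  -- one more customer in station 1
  have G1 : ∀ n j k l : ℕ, 2 * j + k + l = n → m ≤ f 0 j (k + 1) l - f 0 j k l := by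
    intro n
    induction n using Nat.strong_induction_on with
    | _ n ih =>
    intro j k l hn
    have t1 := term_nonneg j μ0 (min (f 0 (j - 1) (k + 1 + 1) l) (f 0 (j - 1) (k + 1) (l + 1)))
      (min (f 0 (j - 1) (k + 1) l) (f 0 (j - 1) k (l + 1))) m hμ0 (fun hj =>
        le_min_sub_min _ _ _ _ _ (ih _ (by omega) (j - 1) (k + 1) l rfl)
          (ih _ (by omega) (j - 1) k (l + 1) rfl))
    have t2 := term_nonneg k μ1 (f 0 j k l) (f 0 j (k - 1) l) m hμ1 (fun hk => by
      have := ih _ (by omega) j (k - 1) l rfl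
      rwa [Nat.sub_add_cancel hk] at this)
    have t3 := term_nonneg (min l CG) μ2 (f 0 j (k + 1) (l - 1)) (f 0 j k (l - 1)) m hμ2
      (fun hl => ih _ (by omega) j k (l - 1) rfl)
    have eY := e0 j (k + 1) l
    have eX := e0 j k l
    have hd := dpos j (k + 1) l (by omega)
    rw [Nat.add_sub_cancel] at eY
    refine le_of_scaled _ _ _ _ hd ?_
    push_cast at *
    linarith
  -- one more customer in station 2
  have G2 : ∀ n j k l : ℕ, 2 * j + k + l = n → m ≤ f 0 j k (l + 1) - f 0 j k l := by
    intro n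
    induction n using Nat.strong_induction_on with
    | _ n ih =>
    intro j k l hn
    have t1 := term_nonneg j μ0 (min (f 0 (j - 1) (k + 1) (l + 1)) (f 0 (j - 1) k (l + 1 + 1)))
      (min (f 0 (j - 1) (k + 1) l) (f 0 (j - 1) k (l + 1))) m hμ0 (fun hj =>
        le_min_sub_min _ _ _ _ _ (ih _ (by omega) (j - 1) (k + 1) l rfl)
          (ih _ (by omega) (j - 1) k (l + 1) rfl))
    have t2 := term_nonneg k μ1 (f 0 j (k - 1) (l + 1)) (f 0 j (k - 1) l) m hμ1 (fun hk =>
      ih _ (by omega) j (k - 1) l rfl)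
    have t3 := term_nonneg (min l CG) μ2 (f 0 j k l) (f 0 j k (l - 1)) m hμ2
      (fun hl => by
        have := ih _ (by omega) j k (l - 1) rfl
        rwa [Nat.sub_add_cancel (by omega)] at this)
    have eY := e0 j k (l + 1)
    have eX := e0 j k l
    have hd := dpos j k (l + 1) (by omega)
    rw [Nat.add_sub_cancel] at eY
    refine le_of_scaled _ _ _ _ hd ?_
    rcases Nat.lt_or_ge l CG with hl | hl
    · rw [min_eq_left (show l + 1 ≤ CG by omega)] at *
      rw [min_eq_left hl.le] at *
      push_cast at *
      linarith
    · rw [min_eq_right (show CG ≤ l + 1 by omega)] at *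
      rw [min_eq_right hl] at *
      push_cast at *
      linarith
  -- one more customer in phase 0
  have F : ∀ n j k l : ℕ, 2 * j + k + l = n → m ≤ f 0 (j + 1) k l - f 0 j k l := by
    intro n
    induction n using Nat.strong_induction_on with
    | _ n ih =>
    intro j k l hn
    have t1 := term_nonneg j μ0 (min (f 0 j (k + 1) l) (f 0 j k (l + 1)))
      (min (f 0 (j - 1) (k + 1) l) (f 0 (j - 1) k (l + 1))) m hμ0 (fun hj => by
        have a := ih _ (by omega) (j - 1) (k + 1) l rfl
        have b := ih _ (by omega) (j - 1) k (l + 1) rfl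
        rw [Nat.sub_add_cancel hj] at a b
        exact le_min_sub_min _ _ _ _ _ a b)
    have t2 := term_nonneg k μ1 (f 0 (j + 1) (k - 1) l) (f 0 j (k - 1) l) m hμ1 (fun hk =>
      ih _ (by omega) j (k - 1) l rfl)
    have t3 := term_nonneg (min l CG) μ2 (f 0 (j + 1) k (l - 1)) (f 0 j k (l - 1)) m hμ2
      (fun hl => ih _ (by omega) j k (l - 1) rfl)
    have t4 : 0 ≤ μ0 * (min (f 0 j (k + 1) l) (f 0 j k (l + 1)) - f 0 j k l - m) := by
      apply mul_nonneg hμ0.le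
      have a := G1 _ j k l rfl
      have b := G2 _ j k l rfl
      have : f 0 j k l + m ≤ min (f 0 j (k + 1) l) (f 0 j k (l + 1)) :=
        le_min (by linarith) (by linarith)
      linarith
    have eY := e0 (j + 1) k l
    have eX := e0 j k l
    have hd := dpos (j + 1) k l (by omega)
    rw [Nat.add_sub_cancel] at eY
    refine le_of_scaled _ _ _ _ hd ?_
    push_cast at *
    linarith
  -- one more customer in the queue
  have E : ∀ n i j k l : ℕ, 2 * (i + j) + k + l = n → 0 < j + k + l →
      m ≤ f (i + 1) j k l - f i j k l := by
    intro n
    induction n using Nat.strong_induction_on with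
    | _ n ih =>
    intro i j k l hn hp
    have t1 := term_nonneg j μ0 (min (f (i + 1) (j - 1) (k + 1) l) (f (i + 1) (j - 1) k (l + 1)))
      (min (f i (j - 1) (k + 1) l) (f i (j - 1) k (l + 1))) m hμ0 (fun hj =>
        le_min_sub_min _ _ _ _ _ (ih _ (by omega) i (j - 1) (k + 1) l rfl (by omega))
          (ih _ (by omega) i (j - 1) k (l + 1) rfl (by omega)))
    have hd := dpos j k l hp
    have eY := eS i j k l hp
    refine le_of_scaled _ _ _ _ hd ?_
    rcases i with _ | i
    · have t2 := term_nonneg k μ1 (f 0 (j + 1) (k - 1) l) (f 0 j (k - 1) l) m hμ1 (fun hk =>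
        F _ j (k - 1) l rfl)
      have t3 := term_nonneg (min l CG) μ2 (f 0 (j + 1) k (l - 1)) (f 0 j k (l - 1)) m hμ2
        (fun hl => F _ j k (l - 1) rfl)
      have eX := e0 j k l
      push_cast at *
      linarith
    · have t2 := term_nonneg k μ1 (f (i + 1) (j + 1) (k - 1) l) (f i (j + 1) (k - 1) l) m hμ1
        (fun hk => ih _ (by omega) i (j + 1) (k - 1) l rfl (by omega))
      have t3 := term_nonneg (min l CG) μ2 (f (i + 1) (j + 1) k (l - 1)) (f i (j + 1) k (l - 1)) m
        hμ2 (fun hl => ih _ (by omega) i (j + 1) k (l - 1) rfl (by omega))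
      have eX := eS i j k l hp
      push_cast at *
      linarith
  -- extra station 1 customer blocking a server
  have D1 : ∀ n i j k l : ℕ, 2 * (i + j) + k + l = n →
      m ≤ f (i + 1) j (k + 1) l - f i (j + 1) k l := by
    intro n
    induction n using Nat.strong_induction_on with
    | _ n ih =>
    intro i j k l hn
    have t1 := term_nonneg j μ0
      (min (f (i + 1) (j - 1) (k + 1 + 1) l) (f (i + 1) (j - 1) (k + 1) (l + 1)))
      (min (f i j (k + 1) l) (f i j k (l + 1))) m hμ0 (fun hj => by
        have a := ih _ (by omega) i (j - 1) (k + 1) l rfl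
        have b := ih _ (by omega) i (j - 1) k (l + 1) rfl
        rw [Nat.sub_add_cancel hj] at a b
        exact le_min_sub_min _ _ _ _ _ a b)
    have t4 : 0 ≤ μ0 * (f (i + 1) j (k + 1) l - min (f i j (k + 1) l) (f i j k (l + 1)) - m) := by
      apply mul_nonneg hμ0.le
      have a := E _ i j (k + 1) l rfl (by omega)
      linarith [min_le_left (f i j (k + 1) l) (f i j k (l + 1))]
    have hd := dpos (j + 1) (k + 1) l (by omega)
    have eY := eS i j (k + 1) l (by omega)
    rw [Nat.add_sub_cancel] at eY
    refine le_of_scaled _ _ _ _ hd ?_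
    rcases i with _ | i
    · have t2 := term_nonneg k μ1 (f 0 (j + 1) k l) (f 0 (j + 1) (k - 1) l) m hμ1 (fun hk => by
        have := G1 _ (j + 1) (k - 1) l rfl
        rwa [Nat.sub_add_cancel hk] at this)
      have t3 := term_nonneg (min l CG) μ2 (f 0 (j + 1) (k + 1) (l - 1)) (f 0 (j + 1) k (l - 1)) m
        hμ2 (fun hl => G1 _ (j + 1) k (l - 1) rfl)
      have eX := e0 (j + 1) k l
      rw [Nat.add_sub_cancel] at eX
      push_cast at *
      linarith
    · have t2 := term_nonneg k μ1 (f (i + 1) (j + 1) k l) (f i (j + 1 + 1) (k - 1) l) m hμ1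
        (fun hk => by
          have := ih _ (by omega) i (j + 1) (k - 1) l rfl
          rwa [Nat.sub_add_cancel hk] at this)
      have t3 := term_nonneg (min l CG) μ2 (f (i + 1) (j + 1) (k + 1) (l - 1))
        (f i (j + 1 + 1) k (l - 1)) m hμ2 (fun hl => ih _ (by omega) i (j + 1) k (l - 1) rfl)
      have eX := eS i (j + 1) k l (by omega)
      rw [Nat.add_sub_cancel] at eX
      push_cast at *
      linarith
  -- extra station 2 customer blocking a server
  have D2 : ∀ n i j k l : ℕ, 2 * (i + j) + k + l = n →
      m ≤ f (i + 1) j k (l + 1) - f i (j + 1) k l := by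
    intro n
    induction n using Nat.strong_induction_on with
    | _ n ih =>
    intro i j k l hn
    have t1 := term_nonneg j μ0
      (min (f (i + 1) (j - 1) (k + 1) (l + 1)) (f (i + 1) (j - 1) k (l + 1 + 1)))
      (min (f i j (k + 1) l) (f i j k (l + 1))) m hμ0 (fun hj => by
        have a := ih _ (by omega) i (j - 1) (k + 1) l rfl
        have b := ih _ (by omega) i (j - 1) k (l + 1) rfl
        rw [Nat.sub_add_cancel hj] at a b
        exact le_min_sub_min _ _ _ _ _ a b)
    have t4 : 0 ≤ μ0 * (f (i + 1) j k (l + 1) - min (f i j (k + 1) l) (f i j k (l + 1)) - m) := by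
      apply mul_nonneg hμ0.le
      have a := E _ i j k (l + 1) rfl (by omega)
      linarith [min_le_right (f i j (k + 1) l) (f i j k (l + 1))]
    have hd := dpos (j + 1) k (l + 1) (by omega)
    have eY := eS i j k (l + 1) (by omega)
    rw [Nat.add_sub_cancel] at eY
    refine le_of_scaled _ _ _ _ hd ?_
    obtain ⟨R, t2, t3, eX⟩ : ∃ R : ℝ × ℝ,
        0 ≤ (k : ℝ) * μ1 * (f i (j + 1) (k - 1) (l + 1) - R.1 - m) ∧
        0 ≤ ((min l CG : ℕ) : ℝ) * μ2 * (f i (j + 1) k l - R.2 - m) ∧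
        (((j + 1 : ℕ) : ℝ) * μ0 + (k : ℝ) * μ1 + ((min l CG : ℕ) : ℝ) * μ2) * f i (j + 1) k l =
        ((i : ℝ) + ((j + 1 : ℕ) : ℝ)) * h0 + (k : ℝ) * h1 + (l : ℝ) * h2
        + ((j + 1 : ℕ) : ℝ) * μ0 * min (f i j (k + 1) l) (f i j k (l + 1))
        + (k : ℝ) * μ1 * R.1 + ((min l CG : ℕ) : ℝ) * μ2 * R.2 := by
      rcases i with _ | i
      · refine ⟨(f 0 (j + 1) (k - 1) l, f 0 (j + 1) k (l - 1)), ?_, ?_, ?_⟩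
        · exact term_nonneg _ _ _ _ _ hμ1 (fun hk => G2 _ (j + 1) (k - 1) l rfl)
        · refine term_nonneg _ _ _ _ _ hμ2 (fun hl => ?_)
          have := G2 _ (j + 1) k (l - 1) rfl
          rwa [Nat.sub_add_cancel (by omega)] at this
        · have eX := e0 (j + 1) k l
          rw [Nat.add_sub_cancel] at eX
          rw [eX]
          push_cast
          ring
      · refine ⟨(f i (j + 1 + 1) (k - 1) l, f i (j + 1 + 1) k (l - 1)), ?_, ?_, ?_⟩
        · exact term_nonneg _ _ _ _ _ hμ1 (fun hk => ih _ (by omega) i (j + 1) (k - 1) l rfl)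
        · refine term_nonneg _ _ _ _ _ hμ2 (fun hl => ?_)
          have := ih _ (by omega) i (j + 1) k (l - 1) rfl
          rwa [Nat.sub_add_cancel (by omega)] at this
        · have eX := eS i (j + 1) k l (by omega)
          rw [Nat.add_sub_cancel] at eX
          rw [eX]
          push_cast
          ring
    rcases Nat.lt_or_ge l CG with hl | hl
    · rw [min_eq_left (show l + 1 ≤ CG by omega)] at *
      rw [min_eq_left hl.le] at *
      push_cast at *
      linarith
    · rw [min_eq_right (show CG ≤ l + 1 by omega)] at *
      rw [min_eq_right hl] at *
      push_cast at *
      linarith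
  exact fun i j k l _ => ⟨D1 _ i j k l rfl, D2 _ i j k l rfl⟩

theorem stmt14 (Cp CG : ℕ) (μ0 μ1 μ2 h0 h1 h2 : ℝ)
    (hCp : 0 < Cp) (hCG : 0 < CG) (hCpCG : CG < Cp)
    (hμ0 : 0 < μ0) (hμ1 : 0 < μ1) (hμ2 : 0 < μ2)
    (hh0 : 0 < h0) (hh1 : 0 < h1) (hh2 : 0 < h2)
    : ∀ i j k l : ℕ, 1 ≤ j → j + k + l = Cp →
      min (h1 / μ1) (h2 / μ2) ≤
          v μ0 μ1 μ2 h0 h1 h2 CG (i + 1) (j - 1) (k + 1) l - v μ0 μ1 μ2 h0 h1 h2 CG i j k l ∧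
      min (h1 / μ1) (h2 / μ2) ≤
          v μ0 μ1 μ2 h0 h1 h2 CG (i + 1) (j - 1) k (l + 1) - v μ0 μ1 μ2 h0 h1 h2 CG i j k l := by
  intro i j k l hj hs
  obtain ⟨j, rfl⟩ : ∃ j', j = j' + 1 := ⟨j - 1, by omega⟩
  rw [Nat.add_sub_cancel]
  refine coupling (v μ0 μ1 μ2 h0 h1 h2 CG) Cp CG μ0 μ1 μ2 h0 h1 h2 _ hCG hμ0 hμ1 hμ2 hh0
    ?_ ?_ hh2 (v_eq_zero μ0 μ1 μ2 h0 h1 h2 CG hCG hμ0 hμ1 hμ2)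
    (v_eq_succ μ0 μ1 μ2 h0 h1 h2 CG hCG hμ0 hμ1 hμ2) i j k l hs
  · rw [← le_div_iff₀ hμ1]
    exact min_le_left _ _
  · rw [← le_div_iff₀ hμ2]
    exact min_le_right _ _
end

section
/- Suppose CG < Cp and μ1 ≥ μ2. Then for every decision state (i,j,k,l) ∈ X_D one has v(i,j-1,k+1,l) − v(i,j-1,k,l+1) ≤ h1/μ1 − h2/μ2. -/
/-- State after a departure: a waiting job (if any) takes the freed place. -/
def remV (V : ℕ → ℕ → ℕ → ℕ → ℝ) : ℕ → ℕ → ℕ → ℕ → ℝ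
  | 0, j, k, l => V 0 j k l
  | i + 1, j, k, l => V i (j + 1) k l

/-- The Bellman equations, together with the positivity assumptions. -/
structure Bell (μ0 μ1 μ2 h0 h1 h2 : ℝ) (g : ℕ → ℝ) (V : ℕ → ℕ → ℕ → ℕ → ℝ) : Prop where
  p0 : 0 < μ0
  p1 : 0 < μ1
  p2 : 0 < μ2
  q0 : 0 < h0
  q1 : 0 < h1
  q2 : 0 < h2
  g0 : g 0 = 0
  gn : ∀ l, 0 ≤ g l
  gp : ∀ l, 0 < g (l + 1)
  gs : ∀ l, g (l + 1) = g l + 1 ∨ g (l + 1) = g l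
  e : ∀ i j k l : ℕ, (i = 0 ∨ 0 < j + k + l) →
    ((j : ℝ) * μ0 + k * μ1 + g l * μ2) * V i j k l =
      ((i : ℝ) + j) * h0 + k * h1 + l * h2
      + j * (μ0 * min (V i (j - 1) (k + 1) l) (V i (j - 1) k (l + 1)))
      + k * (μ1 * remV V i j (k - 1) l) + g l * (μ2 * remV V i j k (l - 1))

section
variable {μ0 μ1 μ2 h0 h1 h2 : ℝ} {g : ℕ → ℝ} {V : ℕ → ℕ → ℕ → ℕ → ℝ}

theorem Bell.dpos (B : Bell μ0 μ1 μ2 h0 h1 h2 g V) (j k l : ℕ) (h : 0 < j + k + l) :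
    0 < (j : ℝ) * μ0 + k * μ1 + g l * μ2 := by
  have := B.p0; have := B.p1; have := B.p2; have := B.gn l
  rcases j with _ | j
  · rcases k with _ | k
    · rcases l with _ | l
      · omega
      · have := B.gp l
        positivity
    · positivity
  · positivity

theorem natMul (n : ℕ) (μ a b : ℝ) (hμ : 0 < μ) (h : 0 < n → a ≤ b) :
    (n : ℝ) * (μ * a) ≤ n * (μ * b) := by
  rcases Nat.eq_zero_or_pos n with rfl | hn
  · simp
  · have := h hn
    gcongr

theorem Bell.gMul (B : Bell μ0 μ1 μ2 h0 h1 h2 g V) (n : ℕ) (μ a b : ℝ) (hμ : 0 < μ)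
    (h : 0 < n → a ≤ b) : g n * (μ * a) ≤ g n * (μ * b) := by
  rcases Nat.eq_zero_or_pos n with rfl | hn
  · simp [B.g0]
  · have := h hn
    have := B.gn n
    gcongr

theorem min_shift {a b c d w : ℝ} (h1 : a + w ≤ c) (h2 : b + w ≤ d) :
    min a b + w ≤ min c d :=
  le_min ((add_le_add_left (min_le_left a b) w).trans h1)
    ((add_le_add_left (min_le_right a b) w).trans h2)

theorem Bell.K0 (B : Bell μ0 μ1 μ2 h0 h1 h2 g V) (w : ℝ) (hw : μ1 * w = h1) :
    ∀ N j k l : ℕ, 2 * j + k + l < N → V 0 j k l + w ≤ V 0 j (k + 1) l := by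
  intro N
  induction N with
  | zero => intro j k l h; omega
  | succ N ih =>
    intro j k l h
    have e1 := B.e 0 j (k + 1) l (Or.inl rfl)
    have e2 := B.e 0 j k l (Or.inl rfl)
    simp only [remV, Nat.add_sub_cancel] at e1 e2
    have d := B.dpos j (k + 1) l (by omega)
    have hj := natMul j μ0 (min (V 0 (j - 1) (k + 1) l) (V 0 (j - 1) k (l + 1)) + w)
      (min (V 0 (j - 1) (k + 1 + 1) l) (V 0 (j - 1) (k + 1) (l + 1))) B.p0
      (fun hj => min_shift (ih _ _ _ (by omega)) (ih _ _ _ (by omega)))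
    have hk := natMul k μ1 (V 0 j (k - 1) l + w) (V 0 j k l) B.p1
      (fun hk => by have := ih j (k - 1) l (by omega); rwa [Nat.sub_add_cancel hk] at this)
    have hl := B.gMul l μ2 (V 0 j k (l - 1) + w) (V 0 j (k + 1) (l - 1)) B.p2
      (fun hl => ih _ _ _ (by omega))
    refine le_of_mul_le_mul_left ?_ d
    push_cast at e1 e2 ⊢
    linear_combination e2 - e1 + hj + hk + hl + hw

theorem Bell.W0 (B : Bell μ0 μ1 μ2 h0 h1 h2 g V) (w : ℝ) (hw : μ2 * w = h2) :
    ∀ N j k l : ℕ, 2 * j + k + l < N → V 0 j k l + w ≤ V 0 j k (l + 1) := by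
  intro N
  induction N with
  | zero => intro j k l h; omega
  | succ N ih =>
    intro j k l h
    have e1 := B.e 0 j k (l + 1) (Or.inl rfl)
    have e2 := B.e 0 j k l (Or.inl rfl)
    simp only [remV, Nat.add_sub_cancel] at e1 e2
    have d := B.dpos j k (l + 1) (by omega)
    have hj := natMul j μ0 (min (V 0 (j - 1) (k + 1) l) (V 0 (j - 1) k (l + 1)) + w)
      (min (V 0 (j - 1) (k + 1) (l + 1)) (V 0 (j - 1) k (l + 1 + 1))) B.p0
      (fun hj => min_shift (ih _ _ _ (by omega)) (ih _ _ _ (by omega)))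
    have hk := natMul k μ1 (V 0 j (k - 1) l + w) (V 0 j (k - 1) (l + 1)) B.p1
      (fun hk => ih _ _ _ (by omega))
    have hl := B.gMul l μ2 (V 0 j k (l - 1) + w) (V 0 j k l) B.p2
      (fun hl => by have := ih j k (l - 1) (by omega); rwa [Nat.sub_add_cancel hl] at this)
    have := B.q2
    refine le_of_mul_le_mul_left ?_ d
    rcases B.gs l with hg | hg <;> rw [hg] at e1 ⊢ <;> push_cast at e1 e2 ⊢
    · linear_combination e2 - e1 + hj + hk + hl + hw
    · linear_combination e2 - e1 + hj + hk + hl + this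

theorem Bell.U0 (B : Bell μ0 μ1 μ2 h0 h1 h2 g V) (m : ℝ)
    (hm1 : m ≤ h1 / μ1) (hm2 : m ≤ h2 / μ2) :
    ∀ N j k l : ℕ, 2 * j + k + l < N → V 0 j k l + m ≤ V 0 (j + 1) k l := by
  intro N
  induction N with
  | zero => intro j k l h; omega
  | succ N ih =>
    intro j k l h
    have e1 := B.e 0 (j + 1) k l (Or.inl rfl)
    have e2 := B.e 0 j k l (Or.inl rfl)
    simp only [remV, Nat.add_sub_cancel] at e1 e2
    have d := B.dpos (j + 1) k l (by omega)
    have hj := natMul j μ0 (min (V 0 (j - 1) (k + 1) l) (V 0 (j - 1) k (l + 1)) + m)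
      (min (V 0 j (k + 1) l) (V 0 j k (l + 1))) B.p0
      (fun hj => by
        have a := ih (j - 1) (k + 1) l (by omega)
        have b := ih (j - 1) k (l + 1) (by omega)
        rw [Nat.sub_add_cancel hj] at a b
        exact min_shift a b)
    have hx : μ0 * (V 0 j k l + m) ≤ μ0 * min (V 0 j (k + 1) l) (V 0 j k (l + 1)) := by
      have a := B.K0 (h1 / μ1) (mul_div_cancel₀ _ B.p1.ne') _ j k l (Nat.lt_succ_self _)
      have b := B.W0 (h2 / μ2) (mul_div_cancel₀ _ B.p2.ne') _ j k l (Nat.lt_succ_self _)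
      have := B.p0
      gcongr
      exact le_min (by linarith) (by linarith)
    have hk := natMul k μ1 (V 0 j (k - 1) l + m) (V 0 (j + 1) (k - 1) l) B.p1
      (fun hk => ih _ _ _ (by omega))
    have hl := B.gMul l μ2 (V 0 j k (l - 1) + m) (V 0 (j + 1) k (l - 1)) B.p2
      (fun hl => ih _ _ _ (by omega))
    have := B.q0
    refine le_of_mul_le_mul_left ?_ d
    push_cast at e1 e2 ⊢
    linear_combination e2 - e1 + hj + hk + hl + hx + this

theorem Bell.U (B : Bell μ0 μ1 μ2 h0 h1 h2 g V) (m : ℝ)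
    (hm1 : m ≤ h1 / μ1) (hm2 : m ≤ h2 / μ2) :
    ∀ N i j k l : ℕ, 2 * (i + j) + k + l < N → 0 < j + k + l →
      V i j k l + m ≤ V (i + 1) j k l := by
  intro N
  induction N with
  | zero => intro i j k l h; omega
  | succ N ih =>
    intro i j k l h hp
    have e1 := B.e (i + 1) j k l (Or.inr hp)
    have e2 := B.e i j k l (Or.inr hp)
    have d := B.dpos j k l hp
    have hrem : ∀ k' l', 2 * (i + j) + k' + l' < N →
        remV V i j k' l' + m ≤ remV V (i + 1) j k' l' := by
      intro k' l' h'
      rcases i with _ | i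
      · exact B.U0 m hm1 hm2 _ _ _ _ (Nat.lt_succ_self _)
      · exact ih _ _ _ _ (by omega) (by omega)
    have hj := natMul j μ0 (min (V i (j - 1) (k + 1) l) (V i (j - 1) k (l + 1)) + m)
      (min (V (i + 1) (j - 1) (k + 1) l) (V (i + 1) (j - 1) k (l + 1))) B.p0
      (fun hj => min_shift (ih _ _ _ _ (by omega) (by omega)) (ih _ _ _ _ (by omega) (by omega)))
    have hk := natMul k μ1 _ _ B.p1 (fun hk => hrem (k - 1) l (by omega))
    have hl := B.gMul l μ2 _ _ B.p2 (fun hl => hrem k (l - 1) (by omega))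
    have := B.q0
    refine le_of_mul_le_mul_left ?_ d
    push_cast at e1 e2 ⊢
    linear_combination e2 - e1 + hj + hk + hl + this

theorem Bell.WD (B : Bell μ0 μ1 μ2 h0 h1 h2 g V) (hμ : μ2 ≤ μ1) (w c : ℝ)
    (hw : μ2 * w = h2) (hc : μ1 * (c + w) = h1) :
    ∀ N i j k l : ℕ, 2 * (i + j) + k + l < N →
      remV V i j k l + w ≤ V i j k (l + 1) ∧ V i j (k + 1) l ≤ V i j k (l + 1) + c := by
  have q0 := B.q0
  have q2 := B.q2
  have p0 := B.p0
  have p1 := B.p1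
  have p2 := B.p2
  have hw0 : h2 / μ2 = w := by rw [div_eq_iff p2.ne']; linarith
  have hc0 : h1 / μ1 = c + w := by rw [div_eq_iff p1.ne']; linarith
  intro N
  induction N with
  | zero => intro i j k l h; omega
  | succ N ih =>
    intro i j k l h
    have W : remV V i j k l + w ≤ V i j k (l + 1) := by
      rcases i with _ | i
      · exact B.W0 w hw _ _ _ _ (Nat.lt_succ_self _)
      have e1 := B.e (i + 1) j k (l + 1) (Or.inr (by omega))
      have e2 := B.e i (j + 1) k l (Or.inr (by omega))
      simp only [Nat.add_sub_cancel] at e1 e2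
      have d := B.dpos (j + 1) k (l + 1) (by omega)
      have hj := natMul j μ0 (min (V i j (k + 1) l) (V i j k (l + 1)) + w)
        (min (V (i + 1) (j - 1) (k + 1) (l + 1)) (V (i + 1) (j - 1) k (l + 1 + 1))) B.p0
        (fun hj => by
          have a := (ih (i + 1) (j - 1) (k + 1) l (by omega)).1
          have b := (ih (i + 1) (j - 1) k (l + 1) (by omega)).1
          simp only [remV] at a b
          rw [Nat.sub_add_cancel hj] at a b
          exact min_shift a b)
      have hx : μ0 * (min (V i j (k + 1) l) (V i j k (l + 1)) + w) ≤
          μ0 * V (i + 1) j k (l + 1) := by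
        have a := B.U (min (c + w) w) (by rw [hc0]; exact min_le_left _ _)
          (by rw [hw0]; exact min_le_right _ _) _ i j k (l + 1) (Nat.lt_succ_self _) (by omega)
        have b := (ih i j k l (by omega)).2
        gcongr
        rcases min_choice (c + w) w with hh | hh <;> rw [hh] at a
        · linarith [min_le_left (V i j (k + 1) l) (V i j k (l + 1))]
        · linarith [min_le_right (V i j (k + 1) l) (V i j k (l + 1))]
      have hk := natMul k μ1 (remV V i (j + 1) (k - 1) l + w)
        (remV V (i + 1) j (k - 1) (l + 1)) B.p1
        (fun hk => (ih i (j + 1) (k - 1) l (by omega)).1)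
      have hl := B.gMul l μ2 (remV V i (j + 1) k (l - 1) + w) (remV V (i + 1) j k l) B.p2
        (fun hl => by
          have := (ih i (j + 1) k (l - 1) (by omega)).1
          rwa [Nat.sub_add_cancel hl] at this)
      change V i (j + 1) k l + w ≤ _
      refine le_of_mul_le_mul_left ?_ d
      have hr : remV V (i + 1) j k l = V i (j + 1) k l := rfl
      rw [hr] at e1 hl
      rcases B.gs l with hg | hg <;> rw [hg] at e1 ⊢ <;> push_cast at e1 e2 ⊢
      · linear_combination e2 - e1 + hj + hk + hl + hx + hw
      · linear_combination e2 - e1 + hj + hk + hl + hx + q2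
    refine ⟨W, ?_⟩
    have e1 := B.e i j (k + 1) l (Or.inr (by omega))
    have e2 := B.e i j k (l + 1) (Or.inr (by omega))
    simp only [Nat.add_sub_cancel] at e1 e2
    have d := B.dpos j (k + 1) l (by omega)
    have hrem : ∀ k' l', k' + l' < k + l →
        remV V i j (k' + 1) l' ≤ remV V i j k' (l' + 1) + c := by
      intro k' l' h'
      rcases i with _ | i
      · exact (ih 0 j k' l' (by omega)).2
      · exact (ih i (j + 1) k' l' (by omega)).2
    have hj := natMul j μ0 (min (V i (j - 1) (k + 1 + 1) l) (V i (j - 1) (k + 1) (l + 1)))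
      (min (V i (j - 1) (k + 1) (l + 1)) (V i (j - 1) k (l + 1 + 1)) + c) B.p0
      (fun hj => by
        have a := (ih i (j - 1) (k + 1) l (by omega)).2
        have b := (ih i (j - 1) k (l + 1) (by omega)).2
        have := min_shift (w := -c) (tsub_le_iff_right.2 a) (tsub_le_iff_right.2 b)
        linarith)
    have hk := natMul k μ1 (remV V i j k l) (remV V i j (k - 1) (l + 1) + c) B.p1
      (fun hk => by
        have := hrem (k - 1) l (by omega)
        rwa [Nat.sub_add_cancel hk] at this)
    have hl := B.gMul l μ2 (remV V i j (k + 1) (l - 1)) (remV V i j k l + c) B.p2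
      (fun hl => by
        have := hrem k (l - 1) (by omega)
        rwa [Nat.sub_add_cancel hl] at this)
    have W1 := mul_le_mul_of_nonneg_left W (sub_nonneg.2 hμ)
    have W2 := mul_le_mul_of_nonneg_left W p1.le
    refine le_of_mul_le_mul_left ?_ d
    rcases B.gs l with hg | hg <;> rw [hg] at e2 <;> push_cast at e1 e2 ⊢
    · linear_combination e1 - e2 + hj + hk + hl + W1 + hw - hc
    · linear_combination e1 - e2 + hj + hk + hl + W2 - hc + q2

end

theorem bell_v (CG : ℕ) (μ0 μ1 μ2 h0 h1 h2 : ℝ) (hCG : 0 < CG)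
    (hμ0 : 0 < μ0) (hμ1 : 0 < μ1) (hμ2 : 0 < μ2)
    (hh0 : 0 < h0) (hh1 : 0 < h1) (hh2 : 0 < h2) :
    Bell μ0 μ1 μ2 h0 h1 h2 (fun l => ((min l CG : ℕ) : ℝ)) (v μ0 μ1 μ2 h0 h1 h2 CG) where
  p0 := hμ0
  p1 := hμ1
  p2 := hμ2
  q0 := hh0
  q1 := hh1
  q2 := hh2
  g0 := by simp
  gn l := by positivity
  gp l := by
    have : 0 < min (l + 1) CG := by omega
    exact_mod_cast this
  gs l := by
    have : min (l + 1) CG = min l CG + 1 ∨ min (l + 1) CG = min l CG := by omega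
    exact_mod_cast this
  e := by
    intro i j k l h
    by_cases hz : j + k + l = 0
    · obtain ⟨rfl, rfl, rfl⟩ : j = 0 ∧ k = 0 ∧ l = 0 := by omega
      obtain rfl : i = 0 := by omega
      simp
    have hd : dRate μ0 μ1 μ2 CG j k l ≠ 0 := by
      unfold dRate
      rcases Nat.eq_zero_or_pos j with hj | hj
      · rcases Nat.eq_zero_or_pos k with hk | hk
        · have : 0 < min l CG := by omega
          positivity
        · positivity
      · positivity
    have hdd : (j : ℝ) * μ0 + k * μ1 + ((min l CG : ℕ) : ℝ) * μ2 = dRate μ0 μ1 μ2 CG j k l := rfl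
    have fj : ∀ x : ℝ, (if _ : 1 ≤ j then (j : ℝ) * μ0 * x else 0) = j * (μ0 * x) := by
      intro x
      split_ifs with hj
      · ring
      · obtain rfl : j = 0 := by omega
        simp
    have fk : ∀ x : ℝ, (if _ : 1 ≤ k then (k : ℝ) * μ1 * x else 0) = k * (μ1 * x) := by
      intro x
      split_ifs with hk
      · ring
      · obtain rfl : k = 0 := by omega
        simp
    have fl : ∀ x : ℝ, (if _ : 1 ≤ l then ((min l CG : ℕ) : ℝ) * μ2 * x else 0)
        = ((min l CG : ℕ) : ℝ) * (μ2 * x) := by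
      intro x
      split_ifs with hl
      · ring
      · obtain rfl : l = 0 := by omega
        simp
    beta_reduce
    rw [hdd]
    rcases i with _ | i
    · rw [v.eq_2 _ _ _ _ _ _ _ _ _ _ (by omega), mul_div_cancel₀ _ hd, fj, fk, fl]
      simp only [remV]
      push_cast
      ring
    · rw [v.eq_3, mul_div_cancel₀ _ hd, fj, fk, fl]
      simp only [remV]
      push_cast
      ring

theorem stmt17 (Cp CG : ℕ) (μ0 μ1 μ2 h0 h1 h2 : ℝ)
    (hCp : 0 < Cp) (hCG : 0 < CG) (hCpCG : CG < Cp)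
    (hμ0 : 0 < μ0) (hμ1 : 0 < μ1) (hμ2 : 0 < μ2)
    (hh0 : 0 < h0) (hh1 : 0 < h1) (hh2 : 0 < h2)
    (hμ : μ2 ≤ μ1) :
    ∀ i j k l : ℕ, memX Cp i j k l → 1 ≤ j →
      v μ0 μ1 μ2 h0 h1 h2 CG i (j - 1) (k + 1) l - v μ0 μ1 μ2 h0 h1 h2 CG i (j - 1) k (l + 1) ≤ h1 / μ1 - h2 / μ2 := by
  intro i j k l _ _
  have B := bell_v CG μ0 μ1 μ2 h0 h1 h2 hCG hμ0 hμ1 hμ2 hh0 hh1 hh2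
  have := (B.WD hμ (h2 / μ2) (h1 / μ1 - h2 / μ2) (by field_simp) (by field_simp; ring) _
    i (j - 1) k l (Nat.lt_succ_self _)).2
  linarith
end

section
/- Suppose CG < Cp, μ1 ≥ μ2 and h1/μ1 > h2/μ2. Then for every (i,j,k,l) ∈ ℕ⁴ with i ≥ 1, j ≥ 1 and j+k+l = Cp, one has the explicit affine bound D(i,j,k,l) = v(i,j-1,k+1,l) − v(i,j-1,k,l+1) ≤ (h1/μ1 − h2/μ2) − C1·i, where C1 = ((μ1 − μ2·[l < CG])/d(j-1,k+1,l)) · (μ0/d(j,k,l+1)) · ( h0/(Cp·μ0) + h0/(Cp·μ1) ), [l < CG] denotes the indicator (1 if l < CG, 0 otherwise), d(j-1,k+1,l) = (j-1)·μ0 + (k+1)·μ1 + min(l,CG)·μ2 and d(j,k,l+1) = j·μ0 + k·μ1 + min(l+1,CG)·μ2. Consequently, if μ1 − μ2·[l < CG] > 0 then D(i,j,k,l) ≤ 0 for all i ≥ (h1/μ1 − h2/μ2)/C1. -/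
/-- Abstract form of the recursion. -/
structure Sys (μ0 μ1 μ2 h0 X Y : ℝ) (m e : ℕ → ℝ) (f : ℕ → ℕ → ℕ → ℕ → ℝ) : Prop where
  p0 : 0 < μ0
  p1 : 0 < μ1
  p2 : 0 < μ2
  ph : 0 < h0
  pX : 0 < X
  pXY : X < Y
  p12 : μ2 ≤ μ1
  m0 : m 0 = 0
  ms : ∀ l, m (l + 1) = m l + e l
  e0 : ∀ l, 0 ≤ e l
  e1 : ∀ l, e l ≤ 1
  mn : ∀ l, 0 ≤ m l
  ml : ∀ l, m l ≤ l
  mp : ∀ l, 0 < m (l + 1)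
  E0 : ∀ a k l : ℕ, (a * μ0 + k * μ1 + m l * μ2) * f 0 a k l =
    a * h0 + k * (Y * μ1) + l * (X * μ2)
      + a * μ0 * min (f 0 (a - 1) (k + 1) l) (f 0 (a - 1) k (l + 1))
      + k * μ1 * f 0 a (k - 1) l + m l * μ2 * f 0 a k (l - 1)
  E1 : ∀ i a k l : ℕ, 1 ≤ a + k + l → (a * μ0 + k * μ1 + m l * μ2) * f (i + 1) a k l =
    (i + 1 + a) * h0 + k * (Y * μ1) + l * (X * μ2)
      + a * μ0 * min (f (i + 1) (a - 1) (k + 1) l) (f (i + 1) (a - 1) k (l + 1))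
      + k * μ1 * f i (a + 1) (k - 1) l + m l * μ2 * f i (a + 1) k (l - 1)

theorem min_diff {x1 x2 y1 y2 B : ℝ} (hh1 : B ≤ x1 - y1) (hh2 : B ≤ x2 - y2) :
    B ≤ min x1 x2 - min y1 y2 := by
  have : min y1 y2 + B ≤ min x1 x2 :=
    le_min (by linarith [min_le_left y1 y2]) (by linarith [min_le_right y1 y2])
  linarith

theorem min_diff_up {x1 x2 x3 B : ℝ} (hB : 0 ≤ B) (hh : x2 - x3 ≤ B) :
    min x1 x2 - min x2 x3 ≤ B := by
  have : min x1 x2 - B ≤ min x2 x3 :=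
    le_min (by linarith [min_le_right x1 x2]) (by linarith [min_le_right x1 x2])
  linarith

theorem coef_le {n : ℕ} {c x y : ℝ} (hc : 0 ≤ c) (H : 1 ≤ n → x ≤ y) :
    (n : ℝ) * c * x ≤ n * c * y := by
  rcases Nat.eq_zero_or_pos n with rfl | hn
  · simp
  · exact mul_le_mul_of_nonneg_left (H hn) (by positivity)

section
variable {μ0 μ1 μ2 h0 X Y : ℝ} {m e : ℕ → ℝ} {f : ℕ → ℕ → ℕ → ℕ → ℝ}

theorem Sys.coefm (S : Sys μ0 μ1 μ2 h0 X Y m e f) {n : ℕ} {x y : ℝ} (H : 1 ≤ n → x ≤ y) :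
    m n * μ2 * x ≤ m n * μ2 * y := by
  rcases Nat.eq_zero_or_pos n with rfl | hn
  · simp [S.m0]
  · exact mul_le_mul_of_nonneg_left (H hn) (mul_nonneg (S.mn n) S.p2.le)

theorem Sys.dnn (S : Sys μ0 μ1 μ2 h0 X Y m e f) (a k l : ℕ) :
    0 ≤ (a * μ0 + k * μ1 + m l * μ2) := by
  have := S.p0; have := S.p1; have := S.p2; have := S.mn l
  positivity

theorem Sys.dpos (S : Sys μ0 μ1 μ2 h0 X Y m e f) (a k l : ℕ) (hh : 1 ≤ a + k + l) :
    0 < (a * μ0 + k * μ1 + m l * μ2) := by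
  have := S.p0; have := S.p1; have := S.p2; have := S.mn l
  rcases Nat.eq_zero_or_pos a with rfl | ha
  · rcases Nat.eq_zero_or_pos k with rfl | hk
    · obtain ⟨l, rfl⟩ : ∃ l', l = l' + 1 := ⟨l - 1, by omega⟩
      have := S.mp l
      positivity
    · positivity
  · positivity

theorem Sys.W0 (S : Sys μ0 μ1 μ2 h0 X Y m e f) : ∀ N a k l : ℕ, 2 * a + k + l < N →
    X ≤ f 0 a k (l + 1) - f 0 a k l := by
  intro N
  induction N with
  | zero => intro a k l hh; omega
  | succ N ih =>
    intro a k l hN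
    have q1 := S.E0 a k (l + 1)
    have q2 := S.E0 a k l
    have t1 : a * μ0 * X ≤ a * μ0 * (min (f 0 (a - 1) (k + 1) (l + 1)) (f 0 (a - 1) k (l + 1 + 1))
        - min (f 0 (a - 1) (k + 1) l) (f 0 (a - 1) k (l + 1))) :=
      coef_le S.p0.le fun ha => min_diff (ih _ _ _ (by omega)) (ih _ _ _ (by omega))
    have t2 : k * μ1 * X ≤ k * μ1 * (f 0 a (k - 1) (l + 1) - f 0 a (k - 1) l) :=
      coef_le S.p1.le fun ha => ih _ _ _ (by omega)
    have t3 : m l * μ2 * X ≤ m l * μ2 * (f 0 a k l - f 0 a k (l - 1)) :=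
      S.coefm fun ha => by
        have := ih a k (l - 1) (by omega)
        rwa [Nat.sub_add_cancel ha] at this
    have hd := S.dpos a k (l + 1) (by omega)
    have he : 0 ≤ (1 - e l) * (μ2 * X) :=
      mul_nonneg (by linarith [S.e1 l]) (mul_nonneg S.p2.le S.pX.le)
    refine le_of_mul_le_mul_left ?_ hd
    simp only [S.ms, Nat.add_sub_cancel] at q1 ⊢
    push_cast at q1
    linarith

theorem Sys.K0 (S : Sys μ0 μ1 μ2 h0 X Y m e f) : ∀ N a k l : ℕ, 2 * a + k + l < N →
    X ≤ f 0 a (k + 1) l - f 0 a k l := by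
  intro N
  induction N with
  | zero => intro a k l hh; omega
  | succ N ih =>
    intro a k l hN
    have q1 := S.E0 a (k + 1) l
    have q2 := S.E0 a k l
    have t1 : a * μ0 * X ≤ a * μ0 * (min (f 0 (a - 1) (k + 1 + 1) l) (f 0 (a - 1) (k + 1) (l + 1))
        - min (f 0 (a - 1) (k + 1) l) (f 0 (a - 1) k (l + 1))) :=
      coef_le S.p0.le fun ha => min_diff (ih _ _ _ (by omega)) (ih _ _ _ (by omega))
    have t2 : k * μ1 * X ≤ k * μ1 * (f 0 a k l - f 0 a (k - 1) l) :=
      coef_le S.p1.le fun ha => by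
        have := ih a (k - 1) l (by omega)
        rwa [Nat.sub_add_cancel ha] at this
    have t3 : m l * μ2 * X ≤ m l * μ2 * (f 0 a (k + 1) (l - 1) - f 0 a k (l - 1)) :=
      S.coefm fun ha => ih a k (l - 1) (by omega)
    have hd := S.dpos a (k + 1) l (by omega)
    have he : 0 ≤ (Y - X) * μ1 := mul_nonneg (by linarith [S.pXY]) S.p1.le
    refine le_of_mul_le_mul_left ?_ hd
    simp only [Nat.add_sub_cancel] at q1 ⊢
    push_cast at q1 ⊢
    linarith

theorem Sys.H0 (S : Sys μ0 μ1 μ2 h0 X Y m e f) : ∀ N a k l : ℕ, 2 * a + k + l < N →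
    X + h0 / μ0 ≤ f 0 (a + 1) k l - f 0 a k l := by
  intro N
  induction N with
  | zero => intro a k l hh; omega
  | succ N ih =>
    intro a k l hN
    have q1 := S.E0 (a + 1) k l
    have q2 := S.E0 a k l
    obtain ⟨Z, hZ⟩ : ∃ Z, h0 / μ0 = Z := ⟨_, rfl⟩
    have hZ' : h0 = Z * μ0 := by rw [← hZ]; field_simp [S.p0.ne']
    rw [hZ] at ih ⊢
    have t1 : a * μ0 * (X + Z) ≤ a * μ0 * (min (f 0 a (k + 1) l) (f 0 a k (l + 1))
        - min (f 0 (a - 1) (k + 1) l) (f 0 (a - 1) k (l + 1))) :=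
      coef_le S.p0.le fun ha => by
        have u1 := ih (a - 1) (k + 1) l (by omega)
        have u2 := ih (a - 1) k (l + 1) (by omega)
        rw [Nat.sub_add_cancel ha] at u1 u2
        exact min_diff u1 u2
    have t2 : k * μ1 * (X + Z) ≤ k * μ1 * (f 0 (a + 1) (k - 1) l - f 0 a (k - 1) l) :=
      coef_le S.p1.le fun ha => ih a (k - 1) l (by omega)
    have t3 : m l * μ2 * (X + Z) ≤ m l * μ2 * (f 0 (a + 1) k (l - 1) - f 0 a k (l - 1)) :=
      S.coefm fun ha => ih a k (l - 1) (by omega)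
    have t4 : μ0 * X ≤ μ0 * (min (f 0 a (k + 1) l) (f 0 a k (l + 1)) - f 0 a k l) := by
      refine mul_le_mul_of_nonneg_left ?_ S.p0.le
      have u1 := S.K0 _ a k l (Nat.lt_succ_self _)
      have u2 := S.W0 _ a k l (Nat.lt_succ_self _)
      have : X + f 0 a k l ≤ min (f 0 a (k + 1) l) (f 0 a k (l + 1)) :=
        le_min (by linarith) (by linarith)
      linarith
    have hd := S.dpos (a + 1) k l (by omega)
    refine le_of_mul_le_mul_left ?_ hd
    simp only [Nat.add_sub_cancel] at q1 ⊢
    push_cast at q1 ⊢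
    rw [hZ'] at q1 q2
    linarith

theorem Sys.D0 (S : Sys μ0 μ1 μ2 h0 X Y m e f) : ∀ N a k l : ℕ, 2 * a + k + l < N →
    f 0 a (k + 1) l - f 0 a k (l + 1) ≤ Y - X := by
  intro N
  induction N with
  | zero => intro a k l hh; omega
  | succ N ih =>
    intro a k l hN
    have hXY := S.pXY
    have q1 := S.E0 a (k + 1) l
    have q2 := S.E0 a k (l + 1)
    have t1 : a * μ0 * (min (f 0 (a - 1) (k + 1 + 1) l) (f 0 (a - 1) (k + 1) (l + 1))
        - min (f 0 (a - 1) (k + 1) (l + 1)) (f 0 (a - 1) k (l + 1 + 1))) ≤ a * μ0 * (Y - X) :=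
      coef_le S.p0.le fun ha => min_diff_up (by linarith) (ih _ _ _ (by omega))
    have t2 : k * μ1 * (f 0 a k l - f 0 a (k - 1) (l + 1)) ≤ k * μ1 * (Y - X) :=
      coef_le S.p1.le fun ha => by
        have := ih a (k - 1) l (by omega)
        rwa [Nat.sub_add_cancel ha] at this
    have t3 : m l * μ2 * (f 0 a (k + 1) (l - 1) - f 0 a k l) ≤ m l * μ2 * (Y - X) :=
      S.coefm fun ha => by
        have := ih a k (l - 1) (by omega)
        rwa [Nat.sub_add_cancel ha] at this
    have w := S.W0 _ a k l (Nat.lt_succ_self _)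
    have hd := S.dpos a (k + 1) l (by omega)
    have g : 0 ≤ μ1 - e l * μ2 := by nlinarith [S.e1 l, S.p2, S.p12]
    have t4 : (μ1 - e l * μ2) * X ≤ (μ1 - e l * μ2) * (f 0 a k (l + 1) - f 0 a k l) :=
      mul_le_mul_of_nonneg_left w g
    have he : 0 ≤ (1 - e l) * (μ2 * X) :=
      mul_nonneg (by linarith [S.e1 l]) (mul_nonneg S.p2.le S.pX.le)
    have hx : 0 ≤ μ2 * X := mul_nonneg S.p2.le S.pX.le
    refine le_of_mul_le_mul_left ?_ hd
    simp only [S.ms, Nat.add_sub_cancel] at q1 q2 ⊢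
    push_cast at q1 q2 ⊢
    linarith

/-- Marginal cost of one more waiting customer. -/
theorem Sys.G (S : Sys μ0 μ1 μ2 h0 X Y m e f) (Cp : ℕ) (hCp : 0 < Cp) :
    ∀ N i a k l : ℕ, a + k + l = Cp → 2 * (i + a) + k + l < N →
    X + h0 / (Cp * μ0) * (i + 1 + a) + h0 / (Cp * μ1) * (i + 1) ≤ f (i + 1) a k l - f i a k l := by
  intro N
  induction N with
  | zero => intro i a k l _ hh; omega
  | succ N ih =>
    intro i a k l hC hN
    have hCp' : (0 : ℝ) < Cp := by exact_mod_cast hCp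
    obtain ⟨P, hP⟩ : ∃ P, h0 / (Cp * μ0) = P := ⟨_, rfl⟩
    obtain ⟨Q, hQ⟩ : ∃ Q, h0 / (Cp * μ1) = Q := ⟨_, rfl⟩
    have hP' : h0 = P * (Cp * μ0) := by
      rw [← hP, div_mul_cancel₀]; exact (mul_pos hCp' S.p0).ne'
    have hQ' : h0 = Q * (Cp * μ1) := by
      rw [← hQ, div_mul_cancel₀]; exact (mul_pos hCp' S.p1).ne'
    have Ppos : 0 < P := by rw [← hP]; exact div_pos S.ph (mul_pos hCp' S.p0)
    have Qpos : 0 < Q := by rw [← hQ]; exact div_pos S.ph (mul_pos hCp' S.p1)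
    rw [hP, hQ] at ih ⊢
    have q1 := S.E1 i a k l (by omega)
    have t1 : a * μ0 * (X + P * (i + a) + Q * (i + 1)) ≤
        a * μ0 * (min (f (i + 1) (a - 1) (k + 1) l) (f (i + 1) (a - 1) k (l + 1))
          - min (f i (a - 1) (k + 1) l) (f i (a - 1) k (l + 1))) :=
      coef_le S.p0.le fun ha => by
        have u1 := ih i (a - 1) (k + 1) l (by omega) (by omega)
        have u2 := ih i (a - 1) k (l + 1) (by omega) (by omega)
        rw [Nat.cast_sub ha] at u1 u2
        push_cast at u1 u2
        exact min_diff (by linarith) (by linarith)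
    have hd := S.dpos a k l (by omega)
    have hcap : (a : ℝ) + k + l = Cp := by exact_mod_cast hC
    -- total drift bound
    have hdr : P * (a * μ0) + Q * (k * μ1 + m l * μ2) ≤ h0 := by
      have r1 : P * μ0 = Q * μ1 := by
        have : Cp * (P * μ0) = Cp * (Q * μ1) := by linarith
        exact mul_left_cancel₀ hCp'.ne' this
      have r2 : m l * μ2 ≤ l * μ1 := mul_le_mul (S.ml l) S.p12 S.p2.le (by positivity)
      have r3 : Q * (m l * μ2) ≤ Q * (l * μ1) := mul_le_mul_of_nonneg_left r2 Qpos.le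
      have r4 : h0 = Q * μ1 * (a + k + l) := by rw [hcap, hQ']; ring
      have r5 : P * (a * μ0) = Q * μ1 * a := by rw [← r1]; ring
      linarith
    refine le_of_mul_le_mul_left ?_ hd
    rcases i with _ | i
    · have q2 := S.E0 a k l
      have hz : h0 / μ0 = P * Cp := by
        rw [hP']; field_simp [S.p0.ne']
      have key : ∀ k' l', a + 1 ≤ Cp →
          X + P * (a + 1) ≤ f 0 (a + 1) k' l' - f 0 a k' l' := by
        intro k' l' hx
        have := S.H0 _ a k' l' (Nat.lt_succ_self _)
        rw [hz] at this
        have hx' : (a : ℝ) + 1 ≤ Cp := by exact_mod_cast hx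
        have := mul_le_mul_of_nonneg_left hx' Ppos.le
        linarith
      have t2 : k * μ1 * (X + P * (a + 1)) ≤ k * μ1 * (f 0 (a + 1) (k - 1) l - f 0 a (k - 1) l) :=
        coef_le S.p1.le fun hk => key _ _ (by omega)
      have t3 : m l * μ2 * (X + P * (a + 1)) ≤
          m l * μ2 * (f 0 (a + 1) k (l - 1) - f 0 a k (l - 1)) :=
        S.coefm fun hk => key _ _ (by omega)
      simp only [Nat.cast_zero, zero_add] at *
      linarith
    · have q2 := S.E1 i a k l (by omega)
      push_cast at q1 t1 ⊢
      have t2 : k * μ1 * (X + P * (i + 1 + (a + 1)) + Q * (i + 1)) ≤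
          k * μ1 * (f (i + 1) (a + 1) (k - 1) l - f i (a + 1) (k - 1) l) :=
        coef_le S.p1.le fun hk => by
          have := ih i (a + 1) (k - 1) l (by omega) (by omega)
          push_cast at this
          exact this
      have t3 : m l * μ2 * (X + P * (i + 1 + (a + 1)) + Q * (i + 1)) ≤
          m l * μ2 * (f (i + 1) (a + 1) k (l - 1) - f i (a + 1) k (l - 1)) :=
        S.coefm fun hk => by
          have := ih i (a + 1) k (l - 1) (by omega) (by omega)
          push_cast at this
          exact this
      linarith

/-- Recursive inequality for the gain of a phase-2 completion, with explicit bound. -/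
theorem Sys.W (S : Sys μ0 μ1 μ2 h0 X Y m e f) (Cp : ℕ) (hCp : 0 < Cp) :
    ∀ N i a k l : ℕ, a + k + l + 1 = Cp → 2 * (i + a) + k + l < N →
    X + μ0 / ((a + 1) * μ0 + k * μ1 + m (l + 1) * μ2) *
      (h0 / (Cp * μ0) + h0 / (Cp * μ1)) * (i + 1) ≤ f (i + 1) a k (l + 1) - f i (a + 1) k l := by
  intro N
  induction N with
  | zero => intro i a k l _ hh; omega
  | succ N ih =>
    intro i a k l hC hN
    have hCp' : (0 : ℝ) < Cp := by exact_mod_cast hCp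
    have g := S.G Cp hCp _ i a k (l + 1) (by omega) (Nat.lt_succ_self _)
    have Ppos : 0 < h0 / (Cp * μ0) := div_pos S.ph (mul_pos hCp' S.p0)
    have Qpos : 0 < h0 / (Cp * μ1) := div_pos S.ph (mul_pos hCp' S.p1)
    have ih' : ∀ i a k l : ℕ, a + k + l + 1 = Cp → 2 * (i + a) + k + l < N →
        X ≤ f (i + 1) a k (l + 1) - f i (a + 1) k l := by
      intro i a k l u1 u2
      refine le_trans ?_ (ih i a k l u1 u2)
      have := S.dnn (a + 1) k (l + 1)
      push_cast at this
      have := S.p0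
      have : 0 ≤ μ0 / ((a + 1) * μ0 + k * μ1 + m (l + 1) * μ2) *
        (h0 / (Cp * μ0) + h0 / (Cp * μ1)) * ((i : ℝ) + 1) := by positivity
      linarith
    generalize h0 / (Cp * μ0) = P at *
    generalize h0 / (Cp * μ1) = Q at *
    have hd := S.dpos (a + 1) k (l + 1) (by omega)
    push_cast at hd
    have q1 := S.E1 i a k (l + 1) (by omega)
    have t1 : a * μ0 * X ≤
        a * μ0 * (min (f (i + 1) (a - 1) (k + 1) (l + 1)) (f (i + 1) (a - 1) k (l + 1 + 1))
          - min (f i a (k + 1) l) (f i a k (l + 1))) :=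
      coef_le S.p0.le fun ha => by
        have u1 := ih' i (a - 1) (k + 1) l (by omega) (by omega)
        have u2 := ih' i (a - 1) k (l + 1) (by omega) (by omega)
        rw [Nat.sub_add_cancel ha] at u1 u2
        exact min_diff u1 u2
    have t4 : μ0 * (X + (P + Q) * (i + 1)) ≤
        μ0 * (f (i + 1) a k (l + 1) - min (f i a (k + 1) l) (f i a k (l + 1))) := by
      refine mul_le_mul_of_nonneg_left ?_ S.p0.le
      have : 0 ≤ P * a := by positivity
      linarith [min_le_right (f i a (k + 1) l) (f i a k (l + 1))]
    have he : 0 ≤ (1 - e l) * (μ2 * X) :=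
      mul_nonneg (by linarith [S.e1 l]) (mul_nonneg S.p2.le S.pX.le)
    refine le_of_mul_le_mul_left ?_ hd
    have hl : ((a + 1) * μ0 + k * μ1 + m (l + 1) * μ2) *
        (X + μ0 / ((a + 1) * μ0 + k * μ1 + m (l + 1) * μ2) * (P + Q) * (i + 1)) =
        ((a + 1) * μ0 + k * μ1 + m (l + 1) * μ2) * X + μ0 * (P + Q) * (i + 1) := by
      field_simp
    rw [hl]
    simp only [S.ms, Nat.add_sub_cancel] at q1 ⊢
    push_cast at q1
    rcases i with _ | i
    · have q2 := S.E0 (a + 1) k l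
      have t2 : k * μ1 * X ≤ k * μ1 * (f 0 (a + 1) (k - 1) (l + 1) - f 0 (a + 1) (k - 1) l) :=
        coef_le S.p1.le fun hk => S.W0 _ _ _ _ (Nat.lt_succ_self _)
      have t3 : m l * μ2 * X ≤ m l * μ2 * (f 0 (a + 1) k l - f 0 (a + 1) k (l - 1)) :=
        S.coefm fun hk => by
          have := S.W0 _ (a + 1) k (l - 1) (Nat.lt_succ_self _)
          rwa [Nat.sub_add_cancel hk] at this
      simp only [Nat.add_sub_cancel] at q2
      push_cast at q2
      simp only [Nat.cast_zero, zero_add] at *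
      linarith
    · have q2 := S.E1 i (a + 1) k l (by omega)
      have t2 : k * μ1 * X ≤
          k * μ1 * (f (i + 1) (a + 1) (k - 1) (l + 1) - f i (a + 1 + 1) (k - 1) l) :=
        coef_le S.p1.le fun hk => ih' _ _ _ _ (by omega) (by omega)
      have t3 : m l * μ2 * X ≤
          m l * μ2 * (f (i + 1) (a + 1) k l - f i (a + 1 + 1) k (l - 1)) :=
        S.coefm fun hk => by
          have := ih' i (a + 1) k (l - 1) (by omega) (by omega)
          rwa [Nat.sub_add_cancel hk] at this
      simp only [Nat.add_sub_cancel] at q2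
      push_cast at q1 q2 t4 ⊢
      linarith

theorem Sys.D (S : Sys μ0 μ1 μ2 h0 X Y m e f) (Cp : ℕ) (hCp : 0 < Cp) :
    ∀ N i a k l : ℕ, a + k + l + 1 = Cp → 2 * (i + a) + k + l < N →
    f (i + 1) a (k + 1) l - f (i + 1) a k (l + 1) ≤ Y - X -
      ((μ1 - μ2 * e l) / (a * μ0 + (k + 1) * μ1 + m l * μ2)) *
      (μ0 / ((a + 1) * μ0 + k * μ1 + m (l + 1) * μ2)) *
      (h0 / (Cp * μ0) + h0 / (Cp * μ1)) * (i + 1) := by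
  intro N
  induction N with
  | zero => intro i a k l _ hh; omega
  | succ N ih =>
    intro i a k l hC hN
    have hXY := S.pXY
    have hCp' : (0 : ℝ) < Cp := by exact_mod_cast hCp
    have w := S.W Cp hCp _ i a k l hC (Nat.lt_succ_self _)
    have Ppos : 0 < h0 / (Cp * μ0) := div_pos S.ph (mul_pos hCp' S.p0)
    have Qpos : 0 < h0 / (Cp * μ1) := div_pos S.ph (mul_pos hCp' S.p1)
    have gg : ∀ l, 0 ≤ μ1 - μ2 * e l := fun l => by nlinarith [S.e1 l, S.p2, S.p12]
    have ih' : ∀ i a k l : ℕ, a + k + l + 1 = Cp → 2 * (i + a) + k + l < N →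
        f (i + 1) a (k + 1) l - f (i + 1) a k (l + 1) ≤ Y - X := by
      intro i a k l u1 u2
      refine le_trans (ih i a k l u1 u2) ?_
      have d1 := S.dnn (a + 1) k (l + 1)
      have d2 := S.dnn a (k + 1) l
      push_cast at d1 d2
      have := S.p0
      have := gg l
      have : 0 ≤ ((μ1 - μ2 * e l) / (a * μ0 + (k + 1) * μ1 + m l * μ2)) *
        (μ0 / ((a + 1) * μ0 + k * μ1 + m (l + 1) * μ2)) *
        (h0 / (Cp * μ0) + h0 / (Cp * μ1)) * ((i : ℝ) + 1) := by positivity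
      linarith
    obtain ⟨R, hR⟩ : ∃ R, μ0 / ((a + 1) * μ0 + k * μ1 + m (l + 1) * μ2) *
        (h0 / (Cp * μ0) + h0 / (Cp * μ1)) * ((i : ℝ) + 1) = R := ⟨_, rfl⟩
    rw [hR] at w
    have hd := S.dpos a (k + 1) l (by omega)
    push_cast at hd
    have goal' : ((μ1 - μ2 * e l) / (a * μ0 + (k + 1) * μ1 + m l * μ2)) *
        (μ0 / ((a + 1) * μ0 + k * μ1 + m (l + 1) * μ2)) *
        (h0 / (Cp * μ0) + h0 / (Cp * μ1)) * ((i : ℝ) + 1) =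
        ((μ1 - μ2 * e l) / (a * μ0 + (k + 1) * μ1 + m l * μ2)) * R := by
      rw [← hR]; ring
    rw [goal']
    refine le_of_mul_le_mul_left ?_ hd
    have hl : (a * μ0 + (k + 1) * μ1 + m l * μ2) *
        (Y - X - ((μ1 - μ2 * e l) / (a * μ0 + (k + 1) * μ1 + m l * μ2)) * R) =
        (a * μ0 + (k + 1) * μ1 + m l * μ2) * (Y - X) - (μ1 - μ2 * e l) * R := by
      field_simp
    rw [hl]
    have q1 := S.E1 i a (k + 1) l (by omega)
    have q2 := S.E1 i a k (l + 1) (by omega)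
    have t1 : a * μ0 * (min (f (i + 1) (a - 1) (k + 1 + 1) l) (f (i + 1) (a - 1) (k + 1) (l + 1))
        - min (f (i + 1) (a - 1) (k + 1) (l + 1)) (f (i + 1) (a - 1) k (l + 1 + 1)))
        ≤ a * μ0 * (Y - X) :=
      coef_le S.p0.le fun ha => min_diff_up (by linarith) (ih' _ _ _ _ (by omega) (by omega))
    have ihall : ∀ k' l', a + 1 + k' + l' + 1 = Cp → k' + l' + 1 = k + l →
        f i (a + 1) (k' + 1) l' - f i (a + 1) k' (l' + 1) ≤ Y - X := by
      intro k' l' u1 u2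
      rcases i with _ | i
      · exact S.D0 _ _ _ _ (Nat.lt_succ_self _)
      · exact ih' _ _ _ _ (by omega) (by omega)
    have t2 : k * μ1 * (f i (a + 1) k l - f i (a + 1) (k - 1) (l + 1)) ≤ k * μ1 * (Y - X) :=
      coef_le S.p1.le fun ha => by
        have := ihall (k - 1) l (by omega) (by omega)
        rwa [Nat.sub_add_cancel ha] at this
    have t3 : m l * μ2 * (f i (a + 1) (k + 1) (l - 1) - f i (a + 1) k l) ≤ m l * μ2 * (Y - X) :=
      S.coefm fun ha => by
        have := ihall k (l - 1) (by omega) (by omega)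
        rwa [Nat.sub_add_cancel ha] at this
    have t4 : (μ1 - μ2 * e l) * (X + R) ≤
        (μ1 - μ2 * e l) * (f (i + 1) a k (l + 1) - f i (a + 1) k l) :=
      mul_le_mul_of_nonneg_left w (gg l)
    have he : 0 ≤ (1 - e l) * (μ2 * X) :=
      mul_nonneg (by linarith [S.e1 l]) (mul_nonneg S.p2.le S.pX.le)
    simp only [S.ms, Nat.add_sub_cancel] at q1 q2 ⊢
    push_cast at q1 q2 ⊢
    linarith

end

theorem sys_v (CG : ℕ) (μ0 μ1 μ2 h0 h1 h2 : ℝ) (hCG : 0 < CG)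
    (hμ0 : 0 < μ0) (hμ1 : 0 < μ1) (hμ2 : 0 < μ2)
    (hh0 : 0 < h0) (hh2 : 0 < h2)
    (hμ : μ2 ≤ μ1) (hq : h2 / μ2 < h1 / μ1) :
    Sys μ0 μ1 μ2 h0 (h2 / μ2) (h1 / μ1) (fun l => ((min l CG : ℕ) : ℝ))
      (fun l => if l < CG then (1 : ℝ) else 0) (v μ0 μ1 μ2 h0 h1 h2 CG) := by
  have hpos : ∀ a k l : ℕ, 1 ≤ a + k + l → dRate μ0 μ1 μ2 CG a k l ≠ 0 := by
    intro a k l hh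
    unfold dRate
    apply ne_of_gt
    rcases Nat.eq_zero_or_pos a with rfl | ha
    · rcases Nat.eq_zero_or_pos k with rfl | hk
      · have : 0 < min l CG := by omega
        positivity
      · positivity
    · positivity
  have g1 : ∀ (n : ℕ) (c x : ℝ), (if _ : 1 ≤ n then (n : ℝ) * c * x else 0) = n * c * x := by
    intro n c x
    rcases Nat.eq_zero_or_pos n with rfl | hn
    · simp
    · exact dif_pos (Nat.succ_le_of_lt hn)
  have g2 : ∀ (n : ℕ) (c x : ℝ),
      (if _ : 1 ≤ n then ((min n CG : ℕ) : ℝ) * c * x else 0) = ((min n CG : ℕ) : ℝ) * c * x := by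
    intro n c x
    rcases Nat.eq_zero_or_pos n with rfl | hn
    · simp
    · exact dif_pos (Nat.succ_le_of_lt hn)
  refine ⟨hμ0, hμ1, hμ2, hh0, by positivity, hq, hμ, by simp, ?_, ?_, ?_, ?_, ?_, ?_, ?_, ?_⟩
  · intro l
    by_cases hl : l < CG
    · have : min (l + 1) CG = min l CG + 1 := by omega
      simp only [this, if_pos hl]; push_cast; ring
    · have : min (l + 1) CG = min l CG := by omega
      simp only [this, if_neg hl, add_zero]
  · intro l; beta_reduce; split_ifs <;> norm_num
  · intro l; beta_reduce; split_ifs <;> norm_num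
  · intro l; positivity
  · intro l; beta_reduce; exact_mod_cast min_le_left l CG
  · intro l
    have : 0 < min (l + 1) CG := by omega
    beta_reduce
    exact_mod_cast this
  · intro a k l
    rw [div_mul_cancel₀ _ hμ1.ne', div_mul_cancel₀ _ hμ2.ne']
    by_cases hz : a = 0 ∧ k = 0 ∧ l = 0
    · obtain ⟨rfl, rfl, rfl⟩ := hz
      simp
    · have hd := hpos a k l (by omega)
      change dRate μ0 μ1 μ2 CG a k l * _ = _
      conv_lhs => rw [v.eq_2 _ _ _ _ _ _ _ _ _ _ (by intro x y; omega)]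
      rw [mul_div_cancel₀ _ hd]
      simp only [g1, g2]
  · intro i a k l hh
    rw [div_mul_cancel₀ _ hμ1.ne', div_mul_cancel₀ _ hμ2.ne']
    have hd := hpos a k l hh
    change dRate μ0 μ1 μ2 CG a k l * _ = _
    conv_lhs => rw [v.eq_3]
    rw [mul_div_cancel₀ _ hd]
    simp only [g1, g2]


theorem stmt18 (Cp CG : ℕ) (μ0 μ1 μ2 h0 h1 h2 : ℝ)
    (hCp : 0 < Cp) (hCG : 0 < CG) (hCpCG : CG < Cp)
    (hμ0 : 0 < μ0) (hμ1 : 0 < μ1) (hμ2 : 0 < μ2)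
    (hh0 : 0 < h0) (hh1 : 0 < h1) (hh2 : 0 < h2)
    (hμ : μ2 ≤ μ1) (hq : h2 / μ2 < h1 / μ1) :
    ∀ j k l : ℕ, 1 ≤ j → j + k + l = Cp →
      (∀ i : ℕ, 1 ≤ i →
        v μ0 μ1 μ2 h0 h1 h2 CG i (j - 1) (k + 1) l - v μ0 μ1 μ2 h0 h1 h2 CG i (j - 1) k (l + 1) ≤
          (h1 / μ1 - h2 / μ2) - (((μ1 - μ2 * (if l < CG then (1 : ℝ) else 0)) / dRate μ0 μ1 μ2 CG (j - 1) (k + 1) l) * (μ0 / dRate μ0 μ1 μ2 CG j k (l + 1)) * (h0 / ((Cp : ℝ) * μ0) + h0 / ((Cp : ℝ) * μ1))) * (i : ℝ)) ∧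
      (0 < μ1 - μ2 * (if l < CG then (1 : ℝ) else 0) →
        ∀ i : ℕ,
          (h1 / μ1 - h2 / μ2) / (((μ1 - μ2 * (if l < CG then (1 : ℝ) else 0)) / dRate μ0 μ1 μ2 CG (j - 1) (k + 1) l) * (μ0 / dRate μ0 μ1 μ2 CG j k (l + 1)) * (h0 / ((Cp : ℝ) * μ0) + h0 / ((Cp : ℝ) * μ1))) ≤ (i : ℝ) →
          v μ0 μ1 μ2 h0 h1 h2 CG i (j - 1) (k + 1) l - v μ0 μ1 μ2 h0 h1 h2 CG i (j - 1) k (l + 1) ≤ 0) := by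
  intro j k l hj hC
  obtain ⟨a, rfl⟩ : ∃ a, j = a + 1 := ⟨j - 1, by omega⟩
  have S := sys_v CG μ0 μ1 μ2 h0 h1 h2 hCG hμ0 hμ1 hμ2 hh0 hh2 hμ hq
  have main : ∀ i : ℕ, 1 ≤ i →
      v μ0 μ1 μ2 h0 h1 h2 CG i (a + 1 - 1) (k + 1) l - v μ0 μ1 μ2 h0 h1 h2 CG i (a + 1 - 1) k (l + 1) ≤
        (h1 / μ1 - h2 / μ2) - (((μ1 - μ2 * (if l < CG then (1 : ℝ) else 0)) / dRate μ0 μ1 μ2 CG (a + 1 - 1) (k + 1) l) * (μ0 / dRate μ0 μ1 μ2 CG (a + 1) k (l + 1)) * (h0 / ((Cp : ℝ) * μ0) + h0 / ((Cp : ℝ) * μ1))) * (i : ℝ) := by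
    intro i hi
    obtain ⟨i, rfl⟩ : ∃ i', i = i' + 1 := ⟨i - 1, by omega⟩
    have := S.D Cp hCp _ i a k l (by omega) (Nat.lt_succ_self _)
    simp only [Nat.add_sub_cancel, dRate]
    push_cast at this ⊢
    exact this
  refine ⟨main, ?_⟩
  intro hp i hi
  have d1 := S.dpos (a + 1) k (l + 1) (by omega)
  have d2 := S.dpos a (k + 1) l (by omega)
  have d1' : 0 < dRate μ0 μ1 μ2 CG (a + 1) k (l + 1) := d1
  have d2' : 0 < dRate μ0 μ1 μ2 CG (a + 1 - 1) (k + 1) l := d2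
  have hCp' : (0 : ℝ) < Cp := by exact_mod_cast hCp
  have hC1 : 0 < (((μ1 - μ2 * (if l < CG then (1 : ℝ) else 0)) / dRate μ0 μ1 μ2 CG (a + 1 - 1) (k + 1) l) * (μ0 / dRate μ0 μ1 μ2 CG (a + 1) k (l + 1)) * (h0 / ((Cp : ℝ) * μ0) + h0 / ((Cp : ℝ) * μ1))) := by
    refine mul_pos (mul_pos (div_pos hp d2') (div_pos hμ0 d1')) ?_
    positivity
  have hi1 : 1 ≤ i := by
    have h3 : 0 < (h1 / μ1 - h2 / μ2) := by linarith
    have : (0 : ℝ) < i := lt_of_lt_of_le (div_pos h3 hC1) hi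
    exact_mod_cast this
  have h4 := main i hi1
  have h5 := (div_le_iff₀ hC1).mp hi
  linarith
end
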